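/- arXiv:math/9502209 — 5 statements merged into one kernel-verified Lean document; each statement's English description precedes it below -/
import Mathlib

section
/- Let N = 2^j · N' with 0 ≤ j ≤ 3 and N' odd and squarefree, let k be a positive even integer, and let (a_n) be complex numbers with a_n = O(n^C) for some C > 0. Set f(z) = Σ_{n≥1} a_n e^{2πinz} on ℍ. Suppose f|_k γ = f for all γ ∈ Γ₀(N), f|_k H_N = ε f for some ε ∈ {+1,−1}, f|_k U_q = f|_k ((q,0),(0,1)) for every prime q with q | N and q² ∤ N, and f|_k U_q = 0 for every prime q with q² | N. Then f vanishes at all the cusps of Γ₀(N): for every σ ∈ SL₂(ℤ), (f|_k σ)(z) → 0 as Im(z) → ∞. (Theorem 3.) -/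
open UpperHalfPlane Matrix Complex MatrixGroups Asymptotics Filter Topology
open scoped Manifold

set_option synthInstance.maxHeartbeats 1000000 in
/-- Action of a real 2×2 matrix with positive determinant on the upper
half-plane `ℍ` (junk value `z` if the determinant is not positive). -/
noncomputable def glAct (γ : Matrix (Fin 2) (Fin 2) ℝ) (z : ℍ) : ℍ :=
  if h : 0 < γ.det then
    (⟨Matrix.GeneralLinearGroup.mkOfDetNeZero γ h.ne', by
        simpa [Matrix.GeneralLinearGroup.mkOfDetNeZero] using h⟩ : GL(2, ℝ)⁺) • z
  else z

/-- For an even integer `k`, the weight-`k` slash action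
`(f ∣ₖ γ)(z) = (det γ)^(k/2) (cz+d)^(-k) f(γz)`. -/
noncomputable def slash (k : ℤ) (γ : Matrix (Fin 2) (Fin 2) ℝ) (f : ℍ → ℂ) : ℍ → ℂ :=
  fun z => (γ.det : ℂ) ^ (k / 2) * (γ 1 0 * (z : ℂ) + γ 1 1) ^ (-k) * f (glAct γ z)

/-- An element of `SL(2, ℤ)` as a real matrix. -/
def sl2ToReal (γ : Matrix.SpecialLinearGroup (Fin 2) ℤ) : Matrix (Fin 2) (Fin 2) ℝ :=
  (γ : Matrix (Fin 2) (Fin 2) ℤ).map (Int.cast)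

/-- The function `f(z) = Σ_{n ≥ 1} a_n e^{2πinz}` on the upper half-plane. -/
noncomputable def fourierSeries (a : ℕ → ℂ) : ℍ → ℂ :=
  fun z => ∑' n : ℕ, a (n + 1) *
    Complex.exp (2 * (Real.pi : ℂ) * Complex.I * ((n : ℂ) + 1) * (z : ℂ))

/-- The Dirichlet series `F(s) = Σ_{n ≥ 1} a_n n^{-s}`. -/
noncomputable def dirichletSeries (a : ℕ → ℂ) (s : ℂ) : ℂ :=
  ∑' n : ℕ, a (n + 1) / ((n : ℂ) + 1) ^ s

/-- The action of the Hecke operator `T_p` in weight `k`: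
`f|_k T_p = f|_k ((p,0),(0,1)) + Σ_{b=0}^{p-1} f|_k ((1,b),(0,p))`. -/
noncomputable def heckeT (k : ℤ) (p : ℕ) (f : ℍ → ℂ) : ℍ → ℂ :=
  fun z => slash k !![(p : ℝ), 0; 0, 1] f z +
    ∑ b ∈ Finset.range p, slash k !![1, (b : ℝ); 0, (p : ℝ)] f z

/-- The action of the Atkin–Lehner operator `U_q` in weight `k`:
`f|_k U_q = Σ_{b=0}^{q-1} f|_k ((q,b),(0,q))`. -/
noncomputable def atkinLehnerU (k : ℤ) (q : ℕ) (f : ℍ → ℂ) : ℍ → ℂ :=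
  fun z => ∑ b ∈ Finset.range q, slash k !![(q : ℝ), (b : ℝ); 0, (q : ℝ)] f z

/-- The local factor at the prime `p` of an Euler product of degree 2,
level `N`, and weight `k`. -/
noncomputable def localFactor (a : ℕ → ℂ) (N : ℕ) (k : ℤ) (p : ℕ) (s : ℂ) : ℂ :=
  if p ∣ N then
    (if p ^ 2 ∣ N then 1 else (1 - (p : ℂ) ^ ((k : ℂ) / 2 - 1 - s))⁻¹)
  else (1 - a p * (p : ℂ) ^ (-s) + (p : ℂ) ^ ((k : ℂ) - 1 - 2 * s))⁻¹

lemma add_ne_zero_of_det_pos {γ : Matrix (Fin 2) (Fin 2) ℝ} (h : 0 < γ.det) (z : ℍ) :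
    (γ 1 0 * (z : ℂ) + γ 1 1 : ℂ) ≠ 0 := by
  refine UpperHalfPlane.linear_ne_zero (cd := γ 1) z fun h0 => h.ne' ?_
  have h10 : γ 1 0 = 0 := congrFun h0 0
  have h11 : γ 1 1 = 0 := congrFun h0 1
  simp [Matrix.det_fin_two, h10, h11]

lemma coe_glAct {γ : Matrix (Fin 2) (Fin 2) ℝ} (h : 0 < γ.det) (z : ℍ) :
    (glAct γ z : ℂ) = (γ 0 0 * z + γ 0 1) / (γ 1 0 * z + γ 1 1) := by
  rw [glAct, dif_pos h]
  exact UpperHalfPlane.coe_smul_of_det_pos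
    (g := Matrix.GeneralLinearGroup.mkOfDetNeZero γ h.ne') h z

lemma im_glAct {γ : Matrix (Fin 2) (Fin 2) ℝ} (h : 0 < γ.det) (z : ℍ) :
    (glAct γ z).im = γ.det * z.im / ‖(γ 1 0 * (z : ℂ) + γ 1 1 : ℂ)‖ ^ 2 := by
  have hne := add_ne_zero_of_det_pos h z
  rw [← UpperHalfPlane.coe_im, coe_glAct h, ← Complex.normSq_eq_norm_sq, Complex.div_im,
    ← sub_div, Matrix.det_fin_two]
  congr 1
  simp
  ring

lemma glAct_mul {α β : Matrix (Fin 2) (Fin 2) ℝ} (hα : 0 < α.det) (hβ : 0 < β.det) (z : ℍ) :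
    glAct (α * β) z = glAct α (glAct β z) := by
  have hαβ : 0 < (α * β).det := by rw [Matrix.det_mul]; positivity
  have h1 := add_ne_zero_of_det_pos hβ z
  have h2 := add_ne_zero_of_det_pos hαβ z
  have h3 := add_ne_zero_of_det_pos hα (glAct β z)
  apply UpperHalfPlane.ext
  rw [coe_glAct hαβ, coe_glAct hα]
  rw [coe_glAct hβ] at h3 ⊢
  rw [div_eq_div_iff h2 h3]
  simp only [Matrix.mul_apply, Fin.sum_univ_two]
  push_cast
  field_simp
  ring

lemma slash_mul (k : ℤ) {α β : Matrix (Fin 2) (Fin 2) ℝ} (hα : 0 < α.det) (hβ : 0 < β.det)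
    (f : ℍ → ℂ) : slash k (α * β) f = slash k β (slash k α f) := by
  funext z
  have h1 := add_ne_zero_of_det_pos hβ z
  have hden : ((α * β) 1 0 * (z : ℂ) + (α * β) 1 1 : ℂ) =
      (β 1 0 * z + β 1 1) * (α 1 0 * (glAct β z : ℂ) + α 1 1) := by
    rw [coe_glAct hβ]
    simp only [Matrix.mul_apply, Fin.sum_univ_two]
    push_cast
    field_simp
    ring
  simp only [slash]
  rw [glAct_mul hα hβ, hden, Matrix.det_mul, mul_zpow]
  push_cast
  rw [mul_zpow]
  ring

lemma det_sl2ToReal (σ : SL(2, ℤ)) : (sl2ToReal σ).det = 1 := by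
  have h := σ.det_coe
  rw [Matrix.det_fin_two] at h ⊢
  simp only [sl2ToReal, Matrix.map_apply]
  exact_mod_cast h

lemma sl2ToReal_mul (σ τ : SL(2, ℤ)) : sl2ToReal (σ * τ) = sl2ToReal σ * sl2ToReal τ := by
  ext i j
  simp [sl2ToReal, Matrix.mul_apply, Fin.sum_univ_two]

lemma slash_sl2ToReal_mul (k : ℤ) (σ τ : SL(2, ℤ)) (f : ℍ → ℂ) :
    slash k (sl2ToReal (σ * τ)) f = slash k (sl2ToReal τ) (slash k (sl2ToReal σ) f) := by
  rw [sl2ToReal_mul, slash_mul] <;> simp [det_sl2ToReal]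

lemma slash_sl2ToReal_apply (k : ℤ) (σ : SL(2, ℤ)) (f : ℍ → ℂ) (z : ℍ) :
    slash k (sl2ToReal σ) f z =
      ((σ 1 0 : ℂ) * z + σ 1 1) ^ (-k) * f (glAct (sl2ToReal σ) z) := by
  rw [slash, det_sl2ToReal]
  simp [sl2ToReal]

lemma coe_glAct_sl2ToReal (σ : SL(2, ℤ)) (z : ℍ) :
    (glAct (sl2ToReal σ) z : ℂ) = (σ 0 0 * z + σ 0 1) / (σ 1 0 * z + σ 1 1) := by
  rw [coe_glAct (by simp [det_sl2ToReal])]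
  simp [sl2ToReal]

lemma slash_T_zpow (k m : ℤ) (f : ℍ → ℂ) (z : ℍ) :
    slash k (sl2ToReal (ModularGroup.T ^ m)) f z = f ((m : ℝ) +ᵥ z) := by
  have hT := ModularGroup.coe_T_zpow m
  rw [slash_sl2ToReal_apply]
  have : glAct (sl2ToReal (ModularGroup.T ^ m)) z = (m : ℝ) +ᵥ z := by
    apply UpperHalfPlane.ext
    rw [coe_glAct_sl2ToReal]
    simp [hT, add_comm]
  rw [this]
  simp [hT]

/-- A holomorphic periodic function on `ℍ` with polynomial growth in a vertical strip has a
limit at `i∞`. -/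
lemma exists_tendsto_atImInfty_of_periodic {g : ℍ → ℂ} {h : ℝ} (hh : 0 < h)
    (hper : ∀ z : ℍ, g (h +ᵥ z) = g z)
    (hdiff : DifferentiableOn ℂ (g ∘ ofComplex) {z | 0 < z.im}) {K : ℝ} {M : ℕ}
    (hbd : ∀ z : ℍ, |z.re| ≤ h → 1 ≤ z.im → ‖g z‖ ≤ K * z.im ^ M) :
    ∃ c, Tendsto g atImInfty (𝓝 c) := by
  set G : ℂ → ℂ := g ∘ ofComplex with hG
  have hGper : Function.Periodic G h := by
    intro w
    by_cases! hw : 0 < w.im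
    · have hw' : 0 < (w + h).im := by simp [hw]
      simp only [hG, Function.comp_apply, ofComplex_apply_of_im_pos hw',
        ofComplex_apply_of_im_pos hw]
      rw [← hper ⟨w, hw⟩]
      congr 1
      ext
      simp [add_comm]
    · have hw' : (w + h).im ≤ 0 := by simpa using hw
      simp [hG, ofComplex_apply_of_im_nonpos hw', ofComplex_apply_of_im_nonpos hw]
  have hdiff' : ∀ᶠ z in comap Complex.im atTop, DifferentiableAt ℂ G z := by
    filter_upwards [preimage_mem_comap (Ioi_mem_atTop (0 : ℝ))] with z hz
    exact (hdiff z hz).differentiableAt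
      ((isOpen_lt continuous_const Complex.continuous_im).mem_nhds hz)
  set Φ := Function.Periodic.cuspFunction h G with hΦ
  have hlim : Tendsto (fun q : ℂ => ‖q‖ * (K * (Function.Periodic.invQParam h q).im ^ M))
      (𝓝[≠] 0) (𝓝 0) := by
    have hreal : Tendsto (fun y : ℝ => Real.exp (-(2 * Real.pi / h * y)) * (K * y ^ M)) atTop
        (𝓝 0) := by
      have h0 := (Real.tendsto_pow_mul_exp_neg_atTop_nhds_zero M).comp
        (tendsto_id.const_mul_atTop (r := 2 * Real.pi / h) (by positivity))
      have h1 := h0.const_mul (K * ((2 * Real.pi / h) ^ M)⁻¹)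
      rw [mul_zero] at h1
      refine h1.congr fun y => ?_
      have : (2 * Real.pi / h) ^ M ≠ 0 := by positivity
      simp only [Function.comp_apply, id, mul_pow]
      field_simp
    have him : Tendsto (fun q : ℂ => (Function.Periodic.invQParam h q).im) (𝓝[≠] 0) atTop :=
      tendsto_comap_iff.mp (Function.Periodic.invQParam_tendsto hh)
    refine (hreal.comp him).congr' ?_
    filter_upwards [self_mem_nhdsWithin] with q hq
    have := Function.Periodic.norm_qParam h (Function.Periodic.invQParam h q)
    rw [Function.Periodic.qParam_right_inv hh.ne' hq] at this
    rw [Function.comp_apply, this]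
    congr 2
    ring
  have hΦo : Φ =o[𝓝[≠] 0] fun q => (q - 0)⁻¹ := by
    simp only [sub_zero]
    refine Asymptotics.isLittleO_of_tendsto' ?_ ?_
    · filter_upwards [self_mem_nhdsWithin] with q hq h0
      exact absurd (inv_eq_zero.mp h0) hq
    · refine squeeze_zero_norm' ?_ hlim
      have him : ∀ᶠ q in 𝓝[≠] (0 : ℂ), 1 ≤ (Function.Periodic.invQParam h q).im :=
        (tendsto_comap_iff.mp (Function.Periodic.invQParam_tendsto hh)).eventually_ge_atTop 1
      filter_upwards [self_mem_nhdsWithin, him] with q hq hq1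
      rw [hΦ, Function.Periodic.cuspFunction_eq_of_nonzero h G hq, norm_div, norm_inv, div_inv_eq_mul,
        mul_comm]
      gcongr
      set w := Function.Periodic.invQParam h q with hw
      have hwpos : 0 < w.im := by linarith
      have hre : |w.re| ≤ h := by
        have : w.re = h / (2 * Real.pi) * Complex.arg q := by
          simp only [hw, Function.Periodic.invQParam]
          rw [show (h / (2 * Real.pi * Complex.I) : ℂ) = ((h / (2 * Real.pi) : ℝ) : ℂ) * -Complex.I by
            push_cast
            rw [← div_div, Complex.div_I]
            ring]
          rw [mul_assoc, Complex.re_ofReal_mul]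
          simp [Complex.log_im]
        rw [this, abs_mul, abs_of_pos (by positivity)]
        have := Complex.abs_arg_le_pi q
        calc h / (2 * Real.pi) * |Complex.arg q| ≤ h / (2 * Real.pi) * Real.pi := by gcongr
          _ = h / 2 := by field_simp
          _ ≤ h := by linarith
      simpa [hG, ofComplex_apply_of_im_pos hwpos] using hbd ⟨w, hwpos⟩ hre hq1
  have hΦ0 : (fun q => Φ q - Φ 0) =o[𝓝[≠] 0] fun q => (q - 0)⁻¹ := by
    refine hΦo.sub ?_
    refine Asymptotics.isLittleO_const_left.mpr (Or.inr ?_)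
    simpa [Function.comp_def] using (tendsto_norm_inv_nhdsNE_zero_atTop (α := ℂ))
  have hΦlim := Complex.tendsto_limUnder_of_differentiable_on_punctured_nhds_of_isLittleO
    (Function.Periodic.eventually_differentiableAt_cuspFunction_nhds_ne_zero hh hGper hdiff') hΦ0
  refine ⟨_, ((hΦlim.comp (Function.Periodic.qParam_tendsto hh)).comp
    UpperHalfPlane.tendsto_coe_atImInfty).congr fun z => ?_⟩
  rw [Function.comp_apply, Function.comp_apply, Function.Periodic.eq_cuspFunction hh.ne' hGper]
  simp [hG]

/-- The series `Σ_{n ≥ 1} a_n e^{2πinz}` as a function on all of `ℂ`. -/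
noncomputable def complexFourierSeries (a : ℕ → ℂ) (z : ℂ) : ℂ :=
  ∑' n : ℕ, a (n + 1) * Complex.exp (2 * (Real.pi : ℂ) * Complex.I * ((n : ℂ) + 1) * z)

/-- The terms of a Fourier series with polynomially bounded coefficients are `O(n⁻² (Im z)⁻ᵐ)`
for every large `m`, uniformly on the upper half-plane. -/
lemma exists_norm_fourier_term_le {a : ℕ → ℂ} {C : ℝ}
    (ha : (fun n : ℕ => a n) =O[atTop] fun n : ℕ => (n : ℝ) ^ C) :
    ∃ m₀ : ℕ, ∀ m ≥ m₀, ∃ K : ℝ, 0 ≤ K ∧ ∀ (n : ℕ) (z : ℂ), 0 < z.im →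
      ‖a (n + 1) * Complex.exp (2 * (Real.pi : ℂ) * Complex.I * ((n : ℂ) + 1) * z)‖ ≤
        K / z.im ^ m * (1 / ((n + 1 : ℕ) : ℝ) ^ 2) := by
  obtain ⟨A, hA, hbound⟩ := Asymptotics.bound_of_isBigO_nat_atTop ha
  refine ⟨⌈C⌉₊ + 2, fun m hm => ⟨A * m.factorial, by positivity, fun n z hz => ?_⟩⟩
  set x : ℝ := ((n + 1 : ℕ) : ℝ) with hx
  have hx1 : 1 ≤ x := by simp [hx]
  have hx0 : 0 < x := by linarith
  have hcoef : ‖a (n + 1)‖ ≤ A * x ^ (m - 2) := by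
    have h1 := hbound (x := n + 1) (Real.rpow_pos_of_pos hx0 C).ne'
    rw [Real.norm_of_nonneg (Real.rpow_nonneg hx0.le C)] at h1
    refine h1.trans ?_
    gcongr
    rw [← Real.rpow_natCast]
    refine Real.rpow_le_rpow_of_exponent_le hx1 ((Nat.le_ceil C).trans ?_)
    exact_mod_cast (by omega : ⌈C⌉₊ ≤ m - 2)
  have hexp : ‖Complex.exp (2 * (Real.pi : ℂ) * Complex.I * ((n : ℂ) + 1) * z)‖ ≤
      m.factorial / (x * z.im) ^ m := by
    have hre : (2 * (Real.pi : ℂ) * Complex.I * ((n : ℂ) + 1) * z).re =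
        -(2 * Real.pi * (x * z.im)) := by
      rw [show (2 * (Real.pi : ℂ) * Complex.I * ((n : ℂ) + 1) * z) =
        ((2 * Real.pi * x : ℝ) : ℂ) * (Complex.I * z) by rw [hx]; push_cast; ring,
        Complex.re_ofReal_mul]
      simp
      ring
    have hpos : 0 < x * z.im := by positivity
    have h1 := Real.pow_div_factorial_le_exp (x * z.im) hpos.le m
    have h2 : Real.exp (x * z.im) ≤ Real.exp (2 * Real.pi * (x * z.im)) :=
      Real.exp_le_exp.mpr (le_mul_of_one_le_left hpos.le (by linarith [Real.pi_gt_three]))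
    rw [Complex.norm_exp, hre, Real.exp_neg, inv_le_comm₀ (Real.exp_pos _) (by positivity), inv_div]
    exact h1.trans h2
  rw [norm_mul]
  calc _ ≤ A * x ^ (m - 2) * (m.factorial / (x * z.im) ^ m) := by gcongr
    _ = _ := by
      obtain ⟨l, rfl⟩ := Nat.exists_eq_add_of_le (show 2 ≤ m by omega)
      rw [Nat.add_sub_cancel_left, mul_pow, pow_add]
      field_simp

lemma summable_one_div_succ_sq : Summable fun n : ℕ => 1 / ((n + 1 : ℕ) : ℝ) ^ 2 :=
  (summable_nat_add_iff 1).mpr (Real.summable_one_div_nat_pow.mpr one_lt_two)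

lemma exists_norm_complexFourierSeries_le {a : ℕ → ℂ} {C : ℝ}
    (ha : (fun n : ℕ => a n) =O[atTop] fun n : ℕ => (n : ℝ) ^ C) :
    ∃ m₀ : ℕ, ∀ m ≥ m₀, ∃ K : ℝ, 0 ≤ K ∧ ∀ z : ℂ, 0 < z.im →
      ‖complexFourierSeries a z‖ ≤ K / z.im ^ m := by
  obtain ⟨m₀, h⟩ := exists_norm_fourier_term_le ha
  refine ⟨m₀, fun m hm => ?_⟩
  obtain ⟨K, hK, hle⟩ := h m hm
  refine ⟨K * ∑' n : ℕ, 1 / ((n + 1 : ℕ) : ℝ) ^ 2, by positivity, fun z hz => ?_⟩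
  have := tsum_of_norm_bounded ((summable_one_div_succ_sq.mul_left (K / z.im ^ m)).hasSum)
    fun n => hle n z hz
  rw [tsum_mul_left] at this
  exact this.trans_eq (by ring)

lemma differentiableAt_complexFourierSeries {a : ℕ → ℂ} {C : ℝ}
    (ha : (fun n : ℕ => a n) =O[atTop] fun n : ℕ => (n : ℝ) ^ C) {z : ℂ} (hz : 0 < z.im) :
    DifferentiableAt ℂ (complexFourierSeries a) z := by
  obtain ⟨m, h⟩ := exists_norm_fourier_term_le ha
  obtain ⟨K, hK, hle⟩ := h m le_rfl
  have hopen : IsOpen {w : ℂ | z.im / 2 < w.im} := isOpen_lt continuous_const Complex.continuous_im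
  refine DifferentiableOn.differentiableAt (s := {w : ℂ | z.im / 2 < w.im}) ?_
    (hopen.mem_nhds (by simpa using hz))
  refine Complex.differentiableOn_tsum_of_summable_norm
    (summable_one_div_succ_sq.mul_left (K / (z.im / 2) ^ m)) (fun n => ?_) hopen fun n w hw => ?_
  · fun_prop
  · have hw0 : 0 < w.im := lt_trans (by positivity) hw
    refine (hle n w hw0).trans ?_
    have : z.im / 2 ≤ w.im := le_of_lt hw
    gcongr

/-- A holomorphic function on `ℍ` invariant under `Γ₀(N)`, with at most polynomial growth at the
real line, has a limit at every cusp. -/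
lemma exists_tendsto_slash_of_growth {N : ℕ} (hN : 0 < N) {k : ℤ} {F : ℂ → ℂ}
    (hF : ∀ z : ℂ, 0 < z.im → DifferentiableAt ℂ F z) {m : ℕ} (hm : k ≤ 2 * m) {K : ℝ}
    (hK : 0 ≤ K) (hbd : ∀ z : ℂ, 0 < z.im → ‖F z‖ ≤ K / z.im ^ m)
    (hinv : ∀ γ ∈ CongruenceSubgroup.Gamma0 N,
      slash k (sl2ToReal γ) (fun z : ℍ => F z) = fun z : ℍ => F z)
    (σ : SL(2, ℤ)) :
    ∃ c, Tendsto (slash k (sl2ToReal σ) fun z : ℍ => F z) atImInfty (𝓝 c) := by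
  have hden (z : ℍ) : ((σ 1 0 : ℂ) * z + σ 1 1) ≠ 0 := by
    simpa [sl2ToReal] using add_ne_zero_of_det_pos (γ := sl2ToReal σ) (by simp [det_sl2ToReal]) z
  have him (z : ℍ) : (glAct (sl2ToReal σ) z).im = z.im / ‖(σ 1 0 : ℂ) * z + σ 1 1‖ ^ 2 := by
    rw [im_glAct (by simp [det_sl2ToReal]), det_sl2ToReal, one_mul]
    simp [sl2ToReal]
  obtain ⟨e, he⟩ := Int.eq_ofNat_of_zero_le (show 0 ≤ 2 * (m : ℤ) - k by omega)
  refine exists_tendsto_atImInfty_of_periodic (h := N) (by exact_mod_cast hN) (fun z => ?_) ?_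
    (K := K * (|(σ 1 0 : ℝ)| * (N + 1) + |(σ 1 1 : ℝ)|) ^ e) (M := e) fun z hre hz1 => ?_
  · have hmem : σ * ModularGroup.T ^ (N : ℤ) * σ⁻¹ ∈ CongruenceSubgroup.Gamma0 N := by
      rw [CongruenceSubgroup.Gamma0_mem]
      have : (σ * ModularGroup.T ^ (N : ℤ) * σ⁻¹) 1 0 = -(N : ℤ) * (σ 1 0) ^ 2 := by
        rw [Matrix.SpecialLinearGroup.coe_mul, Matrix.SpecialLinearGroup.coe_mul,
          ModularGroup.coe_T_zpow, Matrix.SpecialLinearGroup.coe_inv, Matrix.adjugate_fin_two]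
        simp [Matrix.mul_apply, Fin.sum_univ_two]
        ring
      rw [this]
      simp
    have h1 := slash_sl2ToReal_mul k (σ * ModularGroup.T ^ (N : ℤ) * σ⁻¹) σ (fun z : ℍ => F z)
    rw [hinv _ hmem, inv_mul_cancel_right, slash_sl2ToReal_mul] at h1
    have h2 := congrFun h1 z
    rw [slash_T_zpow] at h2
    simpa using h2
  · have heq : ∀ z ∈ {z : ℂ | 0 < z.im},
        ((slash k (sl2ToReal σ) fun z : ℍ => F z) ∘ ofComplex) z =
          ((σ 1 0 : ℂ) * z + σ 1 1) ^ (-k) *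
            F ((σ 0 0 * z + σ 0 1) / (σ 1 0 * z + σ 1 1)) := by
      intro z hz
      rw [Function.comp_apply, ofComplex_apply_of_im_pos hz, slash_sl2ToReal_apply,
        coe_glAct_sl2ToReal]
    refine DifferentiableOn.congr (fun z hz => DifferentiableAt.differentiableWithinAt ?_) heq
    have hne := hden ⟨z, hz⟩
    have hpos := (glAct (sl2ToReal σ) ⟨z, hz⟩).im_pos
    rw [← UpperHalfPlane.coe_im, coe_glAct_sl2ToReal] at hpos
    refine DifferentiableAt.mul ?_ ?_
    · exact DifferentiableAt.zpow (by fun_prop) (Or.inl hne)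
    · exact (hF _ hpos).comp z (DifferentiableAt.div (by fun_prop) (by fun_prop) hne)
  · set D : ℂ := (σ 1 0 : ℂ) * z + σ 1 1 with hD
    have hDpos : 0 < ‖D‖ := norm_pos_iff.mpr (hden z)
    have hDle : ‖D‖ ≤ (|(σ 1 0 : ℝ)| * (N + 1) + |(σ 1 1 : ℝ)|) * z.im := by
      have hz : ‖(z : ℂ)‖ ≤ (N + 1) * z.im := by
        refine (Complex.norm_le_abs_re_add_abs_im _).trans ?_
        rw [UpperHalfPlane.coe_re, UpperHalfPlane.coe_im, abs_of_pos z.im_pos]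
        nlinarith [(Nat.cast_nonneg N : (0 : ℝ) ≤ N)]
      calc ‖D‖ ≤ |(σ 1 0 : ℝ)| * ‖(z : ℂ)‖ + |(σ 1 1 : ℝ)| := by
            refine (norm_add_le _ _).trans_eq ?_
            rw [norm_mul]
            simp
        _ ≤ |(σ 1 0 : ℝ)| * ((N + 1) * z.im) + |(σ 1 1 : ℝ)| * z.im := by
            gcongr
            exact le_mul_of_one_le_right (abs_nonneg _) hz1
        _ = _ := by ring
    have hFle := hbd (glAct (sl2ToReal σ) z : ℂ) (glAct (sl2ToReal σ) z).im_pos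
    rw [UpperHalfPlane.coe_im, him z] at hFle
    rw [slash_sl2ToReal_apply, norm_mul, norm_zpow]
    calc ‖D‖ ^ (-k) * ‖F (glAct (sl2ToReal σ) z)‖
        ≤ ‖D‖ ^ (-k) * (K / (z.im / ‖D‖ ^ 2) ^ m) := by gcongr
      _ = K * ‖D‖ ^ e / z.im ^ m := by
        rw [← zpow_natCast ‖D‖ e, ← he, sub_eq_add_neg, zpow_add₀ hDpos.ne',
          show (2 * (m : ℤ)) = ((2 * m : ℕ) : ℤ) by simp, zpow_natCast, pow_mul, div_pow]
        have := z.im_pos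
        field_simp
      _ ≤ K * ‖D‖ ^ e := div_le_self (by positivity) (one_le_pow₀ hz1)
      _ ≤ K * ((|(σ 1 0 : ℝ)| * (N + 1) + |(σ 1 1 : ℝ)|) * z.im) ^ e := by gcongr
      _ = _ := by rw [mul_pow]; ring

/-- The matrix `((1,0),(d,1))`, which sends the cusp `∞` to the cusp `1/d`. -/
def lowerUnipotent (d : ℤ) : SL(2, ℤ) := ⟨!![1, 0; d, 1], by simp⟩

/-- If `gcd(d, N/d) ∣ 2` for every `d ∣ N`, then the cusp `σ∞` of `Γ₀(N)` is equivalent to `1/d`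
with `d` the greatest common divisor of `N` and the lower left entry of `σ`. -/
lemma exists_mul_T_zpow_mul_lowerUnipotent_inv_mem_Gamma0 {N : ℕ}
    (hN : 0 < N) (h2 : ∀ d e : ℕ, N = d * e → Nat.gcd d e ∣ 2) (σ : SL(2, ℤ)) :
    ∃ m : ℤ, σ * ModularGroup.T ^ m * (lowerUnipotent (Int.gcd (σ 1 0) N))⁻¹ ∈
      CongruenceSubgroup.Gamma0 N := by
  set w := σ 1 0 with hw
  set y := σ 1 1 with hy
  have hdet : σ 0 0 * y - σ 0 1 * w = 1 := by
    have := σ.det_coe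
    rwa [Matrix.det_fin_two] at this
  set d := Int.gcd w N with hd
  have hdpos : 0 < d := Int.gcd_pos_of_ne_zero_right _ (by exact_mod_cast hN.ne')
  obtain ⟨w₁, hw₁⟩ : (d : ℤ) ∣ w := Int.gcd_dvd_left ..
  obtain ⟨e, he⟩ : d ∣ N := Int.natCast_dvd_natCast.mp (Int.gcd_dvd_right ..)
  have hcop : Int.gcd w₁ e = 1 := by
    have : d * Int.gcd w₁ e = d := by
      conv_rhs => rw [hd, hw₁, he]
      push_cast
      rw [Int.gcd_mul_left]
      simp
    exact Nat.eq_of_mul_eq_mul_left hdpos (by simpa using this)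
  have hg2 : Int.gcd w e ∣ 2 := by
    refine dvd_trans (Nat.dvd_gcd ?_ ?_) (h2 d e he)
    · refine Int.natCast_dvd_natCast.mp (Int.dvd_coe_gcd (Int.gcd_dvd_left ..) ?_)
      rw [he]
      push_cast
      exact Dvd.dvd.mul_left (Int.gcd_dvd_right ..) _
    · exact Int.natCast_dvd_natCast.mp (Int.gcd_dvd_right ..)
  obtain ⟨t, ht⟩ : (Int.gcd w e : ℤ) ∣ w₁ - y := by
    rcases (Nat.dvd_prime Nat.prime_two).mp hg2 with h1 | h1
    · simp [h1]
    · have hwe : (2 : ℤ) ∣ w := by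
        have : (Int.gcd w e : ℤ) ∣ w := Int.gcd_dvd_left ..
        rwa [h1] at this
      have hee : (2 : ℤ) ∣ e := by
        have : (Int.gcd w e : ℤ) ∣ e := Int.gcd_dvd_right ..
        rwa [h1] at this
      have hw₁odd : ¬ (2 : ℤ) ∣ w₁ := fun h => by
        have := Int.dvd_coe_gcd h hee
        rw [hcop] at this
        norm_num at this
      have hyodd : ¬ (2 : ℤ) ∣ y := fun h => by
        have : (2 : ℤ) ∣ 1 := hdet ▸ (h.mul_left _).sub (hwe.mul_left _)
        norm_num at this
      rw [h1]
      push_cast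
      omega
  refine ⟨Int.gcdA w e * t, ?_⟩
  rw [CongruenceSubgroup.Gamma0_mem]
  have hbez := Int.gcd_eq_gcd_ab w e
  have hentry : (σ * ModularGroup.T ^ (Int.gcdA w e * t) * (lowerUnipotent d)⁻¹) 1 0 =
      w - d * (y + Int.gcdA w e * t * w) := by
    rw [Matrix.SpecialLinearGroup.coe_mul, Matrix.SpecialLinearGroup.coe_mul,
      ModularGroup.coe_T_zpow, Matrix.SpecialLinearGroup.coe_inv, Matrix.adjugate_fin_two]
    simp [Matrix.mul_apply, Fin.sum_univ_two, lowerUnipotent, ← hw, ← hy]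
    ring
  have hN' : (N : ℤ) = d * e := by exact_mod_cast he
  rw [hentry, ZMod.intCast_zmod_eq_zero_iff_dvd, hN']
  refine ⟨Int.gcdB w e * t, ?_⟩
  linear_combination hw₁ + d * ht + d * t * hbez

lemma tendsto_vadd_atImInfty (x : ℝ) : Tendsto (fun z : ℍ => x +ᵥ z) atImInfty atImInfty := by
  refine tendsto_comap_iff.mpr ?_
  simpa [Function.comp_def, atImInfty] using tendsto_comap

lemma tendsto_slash_of_tendsto_slash_lowerUnipotent {N : ℕ} (hN : 0 < N)
    (h2 : ∀ d e : ℕ, N = d * e → Nat.gcd d e ∣ 2) {k : ℤ} {f : ℍ → ℂ}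
    (hinv : ∀ γ ∈ CongruenceSubgroup.Gamma0 N, slash k (sl2ToReal γ) f = f) (σ : SL(2, ℤ)) {c : ℂ}
    (h : Tendsto (slash k (sl2ToReal (lowerUnipotent (Int.gcd (σ 1 0) N))) f) atImInfty (𝓝 c)) :
    Tendsto (slash k (sl2ToReal σ) f) atImInfty (𝓝 c) := by
  obtain ⟨m, hm⟩ := exists_mul_T_zpow_mul_lowerUnipotent_inv_mem_Gamma0 hN h2 σ
  set τ := lowerUnipotent (Int.gcd (σ 1 0) N)
  have hσ : σ = (σ * ModularGroup.T ^ m * τ⁻¹) * τ * ModularGroup.T ^ (-m) := by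
    simp [mul_assoc]
  rw [hσ, slash_sl2ToReal_mul, slash_sl2ToReal_mul, hinv _ hm]
  exact (h.comp (tendsto_vadd_atImInfty ((-m : ℤ) : ℝ))).congr fun z => (slash_T_zpow ..).symm

/-- The value of `f ∣ₖ σ` at `i∞` governs the vertical behaviour of `f` above the cusp `σ∞`. -/
lemma tendsto_vertical_of_tendsto_slash {k : ℤ} {F : ℂ → ℂ} {σ : SL(2, ℤ)} (hw : 0 < σ 1 0) {c : ℂ}
    (h : Tendsto (slash k (sl2ToReal σ) fun z : ℍ => F z) atImInfty (𝓝 c)) :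
    Tendsto (fun t : ℝ => (t : ℂ) ^ k * F ((σ 0 0 : ℂ) / (σ 1 0 : ℂ) + t * Complex.I))
      (𝓝[>] 0) (𝓝 (Complex.I ^ k * (σ 1 0 : ℂ) ^ (-k) * c)) := by
  set w : ℝ := ((σ 1 0 : ℤ) : ℝ) with hwdef
  have hwpos : 0 < w := Int.cast_pos.mpr hw
  have hdet : (σ 0 0 : ℂ) * σ 1 1 - σ 0 1 * σ 1 0 = 1 := by
    have := σ.det_coe
    rw [Matrix.det_fin_two] at this
    exact_mod_cast this
  have him : ∀ t : ℝ, 0 < t →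
      0 < (((1 / (w ^ 2 * t) : ℝ) : ℂ) * Complex.I - ((σ 1 1 / w : ℝ) : ℂ)).im := fun t ht => by
    rw [Complex.sub_im, Complex.im_ofReal_mul, Complex.ofReal_im, Complex.I_im, mul_one, sub_zero]
    positivity
  have htend : Tendsto (fun t : ℝ => ofComplex
      (((1 / (w ^ 2 * t) : ℝ) : ℂ) * Complex.I - ((σ 1 1 / w : ℝ) : ℂ))) (𝓝[>] 0) atImInfty := by
    refine UpperHalfPlane.tendsto_comap_im_ofComplex.comp (tendsto_comap_iff.mpr ?_)
    have h1 : Tendsto (fun t : ℝ => (w ^ 2)⁻¹ * t⁻¹) (𝓝[>] 0) atTop :=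
      tendsto_inv_nhdsGT_zero.const_mul_atTop (by positivity)
    refine h1.congr fun t => ?_
    rw [Function.comp_apply, Complex.sub_im, Complex.im_ofReal_mul, Complex.ofReal_im, Complex.I_im]
    simp [mul_comm]
  refine ((h.comp htend).const_mul (Complex.I ^ k * (σ 1 0 : ℂ) ^ (-k))).congr' ?_
  filter_upwards [self_mem_nhdsWithin] with t ht
  have ht0 : (t : ℂ) ≠ 0 := by exact_mod_cast (ne_of_gt ht : t ≠ 0)
  have hw0 : (σ 1 0 : ℂ) ≠ 0 := by exact_mod_cast hw.ne'
  have hden : (σ 1 0 : ℂ) * (((1 / (w ^ 2 * t) : ℝ) : ℂ) * Complex.I - ((σ 1 1 / w : ℝ) : ℂ)) +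
      σ 1 1 = Complex.I / (σ 1 0 * t) := by
    rw [hwdef]
    push_cast
    field_simp
    ring
  have hI := Complex.I_ne_zero
  rw [Function.comp_apply, ofComplex_apply_of_im_pos (him t ht), slash_sl2ToReal_apply,
    coe_glAct_sl2ToReal, hden]
  have harg : ((σ 0 0 : ℂ) * (((1 / (w ^ 2 * t) : ℝ) : ℂ) * Complex.I - ((σ 1 1 / w : ℝ) : ℂ)) +
      σ 0 1) / (Complex.I / (σ 1 0 * t)) = (σ 0 0 : ℂ) / (σ 1 0 : ℂ) + t * Complex.I := by
    rw [hwdef]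
    push_cast
    rw [div_eq_iff (by positivity)]
    field_simp
    linear_combination (-(σ 1 0 * t : ℂ)) * hdet - (σ 1 0 * t : ℂ) * Complex.I_sq
  rw [harg, div_zpow, mul_zpow, _root_.zpow_neg, _root_.zpow_neg, _root_.zpow_neg]
  have h1 : Complex.I ^ k ≠ 0 := zpow_ne_zero _ hI
  have h2 : (σ 1 0 : ℂ) ^ k ≠ 0 := zpow_ne_zero _ hw0
  have h3 : (t : ℂ) ^ k ≠ 0 := zpow_ne_zero _ ht0
  field_simp

lemma gcd_dvd_two_of_eq_two_pow_mul {j M d e : ℕ} (hj : j ≤ 3) (hodd : Odd M) (hM : Squarefree M)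
    (h : 2 ^ j * M = d * e) : Nat.gcd d e ∣ 2 := by
  have hsq : Nat.gcd d e * Nat.gcd d e ∣ 2 ^ j * M :=
    h ▸ mul_dvd_mul (Nat.gcd_dvd_left ..) (Nat.gcd_dvd_right ..)
  generalize Nat.gcd d e = g at hsq
  have hg0 : g ≠ 0 := by
    rintro rfl
    have : 2 ^ j * M = 0 := by simpa using hsq
    simp [hM.ne_zero] at this
  obtain ⟨i, m, hm, rfl⟩ := Nat.exists_eq_two_pow_mul_odd hg0
  have hm1 : m = 1 := by
    refine Nat.isUnit_iff.mp (hM m ?_)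
    have h1 : m * m ∣ 2 ^ j * M := dvd_trans ⟨2 ^ i * 2 ^ i, by ring⟩ hsq
    exact (Nat.Coprime.pow_right j (Nat.coprime_two_right.mpr (hm.mul hm))).dvd_of_dvd_mul_left h1
  subst hm1
  have h1 : 2 ^ (i + i) ∣ 2 ^ j := by
    have : 2 ^ (i + i) ∣ 2 ^ j * M := dvd_trans ⟨1, by ring⟩ hsq
    exact (Nat.Coprime.pow_left _ (Nat.coprime_two_left.mpr hodd)).dvd_of_dvd_mul_right this
  have h2 : i + i ≤ j := (Nat.pow_dvd_pow_iff_le_right (by norm_num)).mp h1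
  simpa using pow_dvd_pow 2 (show i ≤ 1 by omega)

lemma tendsto_slash_upperTriangular {a b d : ℝ} (ha : 0 < a) (hd : 0 < d) (k : ℤ) {g : ℍ → ℂ}
    (h : Tendsto g atImInfty (𝓝 0)) :
    Tendsto (slash k !![a, b; 0, d] g) atImInfty (𝓝 0) := by
  have hdet : 0 < (!![a, b; 0, d] : Matrix (Fin 2) (Fin 2) ℝ).det := by
    simpa [Matrix.det_fin_two_of] using mul_pos ha hd
  have hact : Tendsto (glAct !![a, b; 0, d]) atImInfty atImInfty := by
    refine tendsto_comap_iff.mpr ?_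
    have h1 : Tendsto (fun z : ℍ => a / d * z.im) atImInfty atTop :=
      tendsto_comap.const_mul_atTop (by positivity)
    refine h1.congr fun z => ?_
    rw [Function.comp_apply, im_glAct hdet]
    simp [Matrix.det_fin_two_of]
    field_simp
  have h2 := (h.comp hact).const_mul
    (((!![a, b; 0, d] : Matrix (Fin 2) (Fin 2) ℝ).det : ℂ) ^ (k / 2) * (d : ℂ) ^ (-k))
  rw [mul_zero] at h2
  exact h2.congr fun z => by simp [slash]

/-- The operator `H_N` carries the cusp `1/e` of `Γ₀(de)` to the cusp `1/d`. -/
lemma tendsto_slash_lowerUnipotent_of_fricke {d e : ℕ} (hd : 0 < d) (he : 0 < e) {k : ℤ}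
    {f : ℍ → ℂ} {ε : ℂ} (hε : ε ≠ 0)
    (hH : slash k !![0, -1; ((d * e : ℕ) : ℝ), 0] f = fun z => ε * f z)
    {σ : SL(2, ℤ)} (hσ : sl2ToReal σ = !![-1, 0; (e : ℝ), -1])
    (h : Tendsto (slash k (sl2ToReal σ) f) atImInfty (𝓝 0)) :
    Tendsto (slash k (sl2ToReal (lowerUnipotent d)) f) atImInfty (𝓝 0) := by
  have hd' : (0 : ℝ) < d := by exact_mod_cast hd
  have he' : (0 : ℝ) < e := by exact_mod_cast he
  have hmul : (!![0, -1; ((d * e : ℕ) : ℝ), 0] : Matrix (Fin 2) (Fin 2) ℝ) *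
      sl2ToReal (lowerUnipotent d) = sl2ToReal σ * !![(d : ℝ), 1; 0, (e : ℝ)] := by
    rw [hσ]
    ext i j
    fin_cases i <;> fin_cases j <;>
      simp [sl2ToReal, lowerUnipotent, Matrix.mul_apply, Fin.sum_univ_two, mul_comm]
  have h1 := tendsto_slash_upperTriangular (b := 1) hd' he' k h
  rw [← slash_mul k (by simp [det_sl2ToReal])
      (by simpa [Matrix.det_fin_two_of] using mul_pos hd' he'),
    ← hmul, slash_mul k (by simpa [Matrix.det_fin_two_of] using mul_pos hd' he')
      (by simp [det_sl2ToReal]), hH] at h1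
  have h2 := h1.const_mul ε⁻¹
  rw [mul_zero] at h2
  refine h2.congr fun z => ?_
  simp only [slash]
  field_simp

/-- A relation `Σ_b F(z + b/q) = μ F(qz)` gives a linear relation between the values of `F` at the
cusps `1/d` and `1/(qd)`. -/
lemma cusp_relation {N : ℕ} {k : ℤ} {F : ℂ → ℂ} {V : ℕ → ℂ}
    (hV : ∀ (u : ℤ) (w : ℕ), 0 < w → IsCoprime u (w : ℤ) →
      Tendsto (fun t : ℝ => (t : ℂ) ^ k * F ((u : ℂ) / w + t * Complex.I)) (𝓝[>] 0)
        (𝓝 (Complex.I ^ k * (w : ℂ) ^ (-k) * V (Nat.gcd w N))))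
    {q d : ℕ} (hq : q.Prime) (hd : 0 < d) (hdN : q * d ∣ N) (hcop : Nat.Coprime q d) {μ : ℂ}
    (hF : ∀ z : ℂ, 0 < z.im → ∑ b ∈ Finset.range q, F (z + b / q) = μ * F (q * z)) :
    ((q : ℂ) - 1) * (q : ℂ) ^ (-k) * V (q * d) + V d = μ * (q : ℂ) ^ (-k) * V d := by
  have hq0 : (q : ℂ) ≠ 0 := by exact_mod_cast hq.ne_zero
  have hd0 : (d : ℂ) ≠ 0 := by exact_mod_cast hd.ne'
  have hdg : Nat.gcd d N = d := Nat.gcd_eq_left (dvd_trans (dvd_mul_left ..) hdN)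
  have hqdg : Nat.gcd (q * d) N = q * d := Nat.gcd_eq_left hdN
  have hcopZ : IsCoprime (q : ℤ) (d : ℤ) := Nat.isCoprime_iff_coprime.mpr hcop
  have hzero := hV 1 d hd isCoprime_one_left
  rw [hdg] at hzero
  have hterm : ∀ b ∈ Finset.range (q - 1), Tendsto
      (fun t : ℝ => (t : ℂ) ^ k * F ((1 : ℂ) / d + t * Complex.I + (b + 1 : ℕ) / q)) (𝓝[>] 0)
      (𝓝 (Complex.I ^ k * ((q * d : ℕ) : ℂ) ^ (-k) * V (q * d))) := by
    intro b hb
    have hbq : b + 1 < q := by have := Finset.mem_range.mp hb; omega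
    have hcopb : IsCoprime ((b + 1 : ℕ) : ℤ) (q : ℤ) :=
      Nat.isCoprime_iff_coprime.mpr (Nat.coprime_of_lt_prime (by omega) hbq hq).symm
    have h1 := hV (q + (b + 1 : ℕ) * d) (q * d) (by have := hq.pos; positivity) (by
      push_cast
      refine IsCoprime.mul_right ?_ ?_
      · have := (hcopb.mul_left hcopZ.symm).add_mul_left_left 1
        push_cast at this
        simpa [add_comm] using this
      · have := hcopZ.add_mul_right_left ((b + 1 : ℕ) : ℤ)
        push_cast at this
        exact this)
    rw [hqdg] at h1
    refine h1.congr fun t => ?_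
    congr 2
    push_cast
    field_simp
    ring
  have hleft : Tendsto (fun t : ℝ => (t : ℂ) ^ k *
      ∑ b ∈ Finset.range q, F ((1 : ℂ) / d + t * Complex.I + b / q)) (𝓝[>] 0)
      (𝓝 (∑ b ∈ Finset.range (q - 1), Complex.I ^ k * ((q * d : ℕ) : ℂ) ^ (-k) * V (q * d) +
        Complex.I ^ k * (d : ℂ) ^ (-k) * V d)) := by
    refine ((tendsto_finsetSum _ hterm).add hzero).congr fun t => ?_
    have hq1 : Finset.range q = Finset.range (q - 1 + 1) := by
      rw [Nat.sub_add_cancel hq.one_le]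
    rw [hq1, Finset.sum_range_succ', mul_add, Finset.mul_sum]
    simp
  have hscale : Tendsto (fun t : ℝ => (q : ℝ) * t) (𝓝[>] 0) (𝓝[>] 0) := by
    have hq' : (0 : ℝ) < q := by exact_mod_cast hq.pos
    refine tendsto_nhdsWithin_iff.mpr ⟨?_, ?_⟩
    · have : Tendsto (fun t : ℝ => (q : ℝ) * t) (𝓝 0) (𝓝 ((q : ℝ) * 0)) :=
        (continuous_const.mul continuous_id).tendsto 0
      rw [mul_zero] at this
      exact this.mono_left nhdsWithin_le_nhds
    · filter_upwards [self_mem_nhdsWithin] with t ht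
      exact mul_pos hq' ht
  have hright := ((hV q d hd hcopZ).comp hscale).const_mul (μ * (q : ℂ) ^ (-k))
  rw [hdg] at hright
  have heq := tendsto_nhds_unique hleft (hright.congr' (by
    filter_upwards [self_mem_nhdsWithin] with t ht
    rw [hF _ (by
      rw [show (1 : ℂ) / d = ((1 / d : ℝ) : ℂ) by push_cast; rfl, Complex.add_im,
        Complex.ofReal_im, Complex.im_ofReal_mul]
      simpa using ht), Function.comp_apply]
    have hqk : (q : ℂ) ^ k ≠ 0 := zpow_ne_zero _ hq0
    push_cast
    rw [mul_zpow, _root_.zpow_neg, show (q : ℂ) * (1 / d + t * Complex.I) =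
      q / d + q * t * Complex.I by ring]
    field_simp))
  have hI : Complex.I ^ k ≠ 0 := zpow_ne_zero _ Complex.I_ne_zero
  have hdk : (d : ℂ) ^ (-k) ≠ 0 := zpow_ne_zero _ hd0
  rw [Finset.sum_const, Finset.card_range, nsmul_eq_mul, Nat.cast_sub hq.one_le, Nat.cast_mul,
    mul_zpow] at heq
  refine mul_left_cancel₀ (mul_ne_zero hI hdk) ?_
  push_cast at heq
  linear_combination heq

/-- If `F(z) + F(z + 1/2) = 0`, then `F` vanishes at the cusps `1/d` with `4 ∣ d`. -/
lemma cusp_value_eq_zero_of_four_dvd {N : ℕ} {k : ℤ} {F : ℂ → ℂ} {V : ℕ → ℂ}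
    (hV : ∀ (u : ℤ) (w : ℕ), 0 < w → IsCoprime u (w : ℤ) →
      Tendsto (fun t : ℝ => (t : ℂ) ^ k * F ((u : ℂ) / w + t * Complex.I)) (𝓝[>] 0)
        (𝓝 (Complex.I ^ k * (w : ℂ) ^ (-k) * V (Nat.gcd w N))))
    {d : ℕ} (hd : 0 < d) (hdN : d ∣ N) (h4 : 4 ∣ d)
    (hF : ∀ z : ℂ, 0 < z.im → F z + F (z + 1 / 2) = 0) : V d = 0 := by
  obtain ⟨e, rfl⟩ := h4
  have hd0 : ((4 * e : ℕ) : ℂ) ≠ 0 := by exact_mod_cast hd.ne'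
  have hcop : IsCoprime (1 + 2 * e : ℤ) ((4 * e : ℕ) : ℤ) := by
    refine ⟨1 - 2 * e, e, ?_⟩
    push_cast
    ring
  have h1 := (hV 1 (4 * e) hd isCoprime_one_left).add (hV (1 + 2 * e) (4 * e) hd hcop)
  rw [Nat.gcd_eq_left hdN] at h1
  have h2 := tendsto_nhds_unique h1 ((tendsto_const_nhds (x := (0 : ℂ))).congr' (by
    filter_upwards [self_mem_nhdsWithin] with t ht
    have := hF (1 / (4 * e : ℕ) + t * Complex.I) (by
      rw [show (1 : ℂ) / (4 * e : ℕ) = ((1 / (4 * e : ℕ) : ℝ) : ℂ) by push_cast; rfl,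
        Complex.add_im, Complex.ofReal_im, Complex.im_ofReal_mul]
      simpa using ht)
    rw [← mul_add, eq_comm]
    refine mul_eq_zero_of_right _ ?_
    rw [← this]
    congr 2
    · push_cast
      rfl
    · have he : (e : ℂ) ≠ 0 := by simpa using hd0
      push_cast
      field_simp
      ring))
  have hI : Complex.I ^ k ≠ 0 := zpow_ne_zero _ Complex.I_ne_zero
  have hdk : ((4 * e : ℕ) : ℂ) ^ (-k) ≠ 0 := zpow_ne_zero _ hd0
  rw [← two_mul] at h2
  exact (mul_eq_zero.mp ((mul_eq_zero.mp h2).resolve_left two_ne_zero)).resolve_left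
    (mul_ne_zero hI hdk)

/-- The values of `F ∣ₖ σ` at `i∞` depend only on `gcd(σ 1 0, N)`, and they describe the
behaviour of `F` at all rational points. -/
lemma exists_cusp_values {N : ℕ} (hN : 0 < N) (h2 : ∀ d e : ℕ, N = d * e → Nat.gcd d e ∣ 2)
    {k : ℤ} {F : ℂ → ℂ}
    (hlim : ∀ σ : SL(2, ℤ), ∃ c, Tendsto (slash k (sl2ToReal σ) fun z : ℍ => F z) atImInfty (𝓝 c))
    (hinv : ∀ γ ∈ CongruenceSubgroup.Gamma0 N,
      slash k (sl2ToReal γ) (fun z : ℍ => F z) = fun z : ℍ => F z) :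
    ∃ V : ℕ → ℂ,
      (∀ σ : SL(2, ℤ), Tendsto (slash k (sl2ToReal σ) fun z : ℍ => F z) atImInfty
        (𝓝 (V (Int.gcd (σ 1 0) N)))) ∧
      ∀ (u : ℤ) (w : ℕ), 0 < w → IsCoprime u (w : ℤ) →
        Tendsto (fun t : ℝ => (t : ℂ) ^ k * F ((u : ℂ) / w + t * Complex.I)) (𝓝[>] 0)
          (𝓝 (Complex.I ^ k * (w : ℂ) ^ (-k) * V (Nat.gcd w N))) := by
  choose V hV using fun d : ℕ => hlim (lowerUnipotent d)
  have hall : ∀ σ : SL(2, ℤ), Tendsto (slash k (sl2ToReal σ) fun z : ℍ => F z) atImInfty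
      (𝓝 (V (Int.gcd (σ 1 0) N))) := fun σ =>
    tendsto_slash_of_tendsto_slash_lowerUnipotent hN h2 hinv σ (hV _)
  refine ⟨V, hall, fun u w hw huw => ?_⟩
  obtain ⟨x, y, hxy⟩ := huw
  let σ : SL(2, ℤ) := ⟨!![u, -y; (w : ℤ), x], by
    rw [Matrix.det_fin_two_of]
    linear_combination hxy⟩
  have h := tendsto_vertical_of_tendsto_slash (σ := σ) (by simpa [σ] using hw) (hall σ)
  simpa [σ] using h

lemma slash_translation {k : ℤ} (hk : Even k) {q : ℝ} (hq : 0 < q) (b : ℝ) (F : ℂ → ℂ) (z : ℍ) :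
    slash k !![q, b; 0, q] (fun z : ℍ => F z) z = F (z + b / q) := by
  have hdet : 0 < (!![q, b; 0, q] : Matrix (Fin 2) (Fin 2) ℝ).det := by
    simpa [Matrix.det_fin_two_of] using mul_pos hq hq
  have hq0 : (q : ℂ) ≠ 0 := by exact_mod_cast hq.ne'
  have hqk : (q : ℂ) ^ k ≠ 0 := zpow_ne_zero _ hq0
  obtain ⟨l, rfl⟩ := hk
  rw [slash, coe_glAct hdet]
  have hl : (l + l) / 2 = l := by omega
  rw [hl]
  simp only [Matrix.det_fin_two_of, Matrix.of_apply, Matrix.cons_val', Matrix.cons_val_zero,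
    Matrix.cons_val_one, Matrix.cons_val_fin_one, mul_zero, sub_zero, Complex.ofReal_mul,
    Complex.ofReal_zero, zero_mul, zero_add]
  rw [mul_zpow, ← zpow_add₀ hq0, ← zpow_add₀ hq0, add_neg_cancel, zpow_zero, one_mul, add_div,
    mul_div_cancel_left₀ _ hq0]

lemma slash_dilation (k : ℤ) {q : ℝ} (hq : 0 < q) (F : ℂ → ℂ) (z : ℍ) :
    slash k !![q, 0; 0, 1] (fun z : ℍ => F z) z = (q : ℂ) ^ (k / 2) * F (q * z) := by
  have hdet : 0 < (!![q, 0; 0, 1] : Matrix (Fin 2) (Fin 2) ℝ).det := by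
    simpa [Matrix.det_fin_two_of] using hq
  rw [slash, coe_glAct hdet]
  simp [Matrix.det_fin_two_of]

lemma sum_translates_of_atkinLehnerU {k : ℤ} (hk : Even k) {q : ℕ} (hq : 0 < q) {F : ℂ → ℂ}
    {g : ℍ → ℂ} (h : atkinLehnerU k q (fun z : ℍ => F z) = g) (z : ℍ) :
    ∑ b ∈ Finset.range q, F (z + b / q) = g z := by
  rw [← h, atkinLehnerU]
  refine Finset.sum_congr rfl fun b _ => ?_
  rw [slash_translation hk (by exact_mod_cast hq)]
  simp

lemma eq_zero_of_sub_one_mul_zpow {q : ℕ} (hq : q.Prime) {k : ℤ} (hk : 0 < k) (hke : Even k)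
    {x y : ℂ} (hy : y = 0)
    (h : ((q : ℂ) - 1) * (q : ℂ) ^ (-k) * y + x = (q : ℂ) ^ (k / 2) * (q : ℂ) ^ (-k) * x) :
    x = 0 := by
  have hq0 : (q : ℂ) ≠ 0 := by exact_mod_cast hq.ne_zero
  obtain ⟨l, rfl⟩ := hke
  have hl : (l + l) / 2 = l := by omega
  rw [hy, mul_zero, zero_add, hl, ← zpow_add₀ hq0, show l + -(l + l) = -l by ring] at h
  by_contra hx
  have h1 : (q : ℂ) ^ (-l) = 1 := mul_right_cancel₀ hx (by rw [one_mul]; exact h.symm)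
  have h2 := congrArg norm h1
  rw [norm_zpow, Complex.norm_natCast, norm_one] at h2
  have h3 : (q : ℝ) ^ (-l) < 1 := zpow_lt_one_of_neg₀ (by exact_mod_cast hq.one_lt) (by omega)
  exact h3.ne h2

/-- Descent from `V N = 0` along the prime divisors of a squarefree `N`. -/
lemma eq_zero_of_dvd_of_squarefree {N : ℕ} (hN : Squarefree N) {V : ℕ → ℂ} (hVN : V N = 0)
    (hstep : ∀ q d : ℕ, q.Prime → 0 < d → q * d ∣ N → Nat.Coprime q d → V (q * d) = 0 → V d = 0)
    {d : ℕ} (hd : d ∣ N) : V d = 0 := by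
  obtain ⟨e, he⟩ := hd
  induction e using induction_on_primes generalizing d with
  | zero => exact absurd (by simpa using he) hN.ne_zero
  | one => rwa [← (by simpa using he : N = d)]
  | prime_mul q e hq ih =>
    have hqd : N = q * d * e := by rw [he]; ring
    refine hstep q d hq (Nat.pos_of_ne_zero ?_) ⟨e, hqd⟩ ?_ (ih hqd)
    · rintro rfl
      exact hN.ne_zero (by simpa using he)
    · exact Nat.coprime_of_squarefree_mul (hN.squarefree_of_dvd ⟨e, hqd⟩)

lemma tendsto_atImInfty_zero_of_norm_le {F : ℂ → ℂ} {m : ℕ} (hm : m ≠ 0) {K : ℝ}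
    (hbd : ∀ z : ℂ, 0 < z.im → ‖F z‖ ≤ K / z.im ^ m) :
    Tendsto (fun z : ℍ => F z) atImInfty (𝓝 0) := by
  refine squeeze_zero_norm (fun z => hbd z z.im_pos) ?_
  exact ((tendsto_const_nhds (x := K)).div_atTop (tendsto_pow_atTop hm)).comp
    (tendsto_comap (f := UpperHalfPlane.im))

/-- If `4 ∣ N`, the relation `F(z) + F(z + 1/2) = 0` together with the involution `H_N` kills all
cusps. -/
lemma eq_zero_of_dvd_of_four_dvd {j M : ℕ} (hj2 : 2 ≤ j) {k : ℤ}
    {V : ℕ → ℂ} (h4 : ∀ d, d ∣ 2 ^ j * M → 4 ∣ d → V d = 0)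
    (h2 : ∀ d, 2 * d ∣ 2 ^ j * M → Odd d → (2 : ℂ) ^ (-k) * V (2 * d) + V d = 0)
    (hfricke : ∀ d e, 2 ^ j * M = d * e → V e = 0 → V d = 0) {d : ℕ} (hd : d ∣ 2 ^ j * M) :
    V d = 0 := by
  have hodd : ∀ d, d ∣ 2 ^ j * M → Odd d → V d = 0 := fun d hd hdo => by
    have hdM : d ∣ M :=
      (Nat.Coprime.pow_right j (Nat.coprime_two_right.mpr hdo)).dvd_of_dvd_mul_left hd
    obtain ⟨e, rfl⟩ := hdM
    have h22 : 4 ∣ 2 ^ j := pow_dvd_pow 2 hj2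
    exact hfricke d (2 ^ j * e) (by ring) (h4 _ (mul_dvd_mul_left _ (dvd_mul_left ..))
      (h22.mul_right _))
  by_cases hd4 : 4 ∣ d
  · exact h4 d hd hd4
  rcases Nat.even_or_odd d with he | ho
  · obtain ⟨c, rfl⟩ := he.two_dvd
    have hco : Odd c := by
      rw [← Nat.not_even_iff_odd, even_iff_two_dvd]
      intro hc
      exact hd4 (mul_dvd_mul_left 2 hc)
    have h := h2 c hd hco
    rw [hodd c (dvd_trans (dvd_mul_left ..) hd) hco, add_zero] at h
    exact (mul_eq_zero.mp h).resolve_left (zpow_ne_zero _ two_ne_zero)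
  · exact hodd d hd ho

/-- **Theorem 3.** Let `N = 2^j N'` with `0 ≤ j ≤ 3` and `N'` odd and
squarefree. If `f(z) = Σ a_n e^{2πinz}` (with `a_n = O(n^C)`) is invariant
under `Γ₀(N)`, is an eigenfunction of `H_N` with eigenvalue `±1`, and
satisfies `f|_k U_q = f|_k ((q,0),(0,1))` for `q ∥ N` and `f|_k U_q = 0` for
`q² | N`, then `f` vanishes at all the cusps of `Γ₀(N)`. -/
theorem theorem_three
    (N j N' : ℕ) (hNfact : N = 2 ^ j * N') (hj : j ≤ 3)
    (hN'odd : Odd N') (hN'sqfree : Squarefree N')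
    (k : ℤ) (hkpos : 0 < k) (hkeven : Even k)
    (a : ℕ → ℂ) (C : ℝ) (hC : 0 < C)
    (hgrowth : (fun n : ℕ => a n) =O[atTop] fun n : ℕ => (n : ℝ) ^ C)
    (ε : ℝ) (hε : ε = 1 ∨ ε = -1)
    (hGamma0 : ∀ γ ∈ CongruenceSubgroup.Gamma0 N,
      slash k (sl2ToReal γ) (fourierSeries a) = fourierSeries a)
    (hH : slash k !![0, -1; (N : ℝ), 0] (fourierSeries a)
      = fun z => (ε : ℂ) * fourierSeries a z)
    (hU1 : ∀ q : ℕ, q.Prime → q ∣ N → ¬ q ^ 2 ∣ N →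
      atkinLehnerU k q (fourierSeries a)
        = slash k !![(q : ℝ), 0; 0, 1] (fourierSeries a))
    (hU2 : ∀ q : ℕ, q.Prime → q ^ 2 ∣ N →
      atkinLehnerU k q (fourierSeries a) = 0) :
    ∀ σ : Matrix.SpecialLinearGroup (Fin 2) ℤ,
      Tendsto (slash k (sl2ToReal σ) (fourierSeries a)) atImInfty (𝓝 0) := by
  have hM : 0 < N' := hN'sqfree.ne_zero.bot_lt
  have hN : 0 < N := by rw [hNfact]; positivity
  have hgcd : ∀ d e : ℕ, N = d * e → Nat.gcd d e ∣ 2 := fun d e h =>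
    gcd_dvd_two_of_eq_two_pow_mul hj hN'odd hN'sqfree (hNfact ▸ h)
  obtain ⟨m₀, hm₀⟩ := exists_norm_complexFourierSeries_le hgrowth
  obtain ⟨K, hK, hbd⟩ := hm₀ (m₀ + k.toNat + 1) (by omega)
  obtain ⟨V, hlim, hV⟩ := exists_cusp_values hN hgcd
    (exists_tendsto_slash_of_growth (F := complexFourierSeries a) hN
      (fun z hz => differentiableAt_complexFourierSeries hgrowth hz) (by push_cast; omega) hK hbd
      hGamma0) hGamma0
  have hVl : ∀ {d : ℕ}, d ∣ N →
      Tendsto (slash k (sl2ToReal (lowerUnipotent d)) (fourierSeries a)) atImInfty (𝓝 (V d)) := by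
    intro d hd
    have h := hlim (lowerUnipotent d)
    have hgd : Int.gcd ((lowerUnipotent d) 1 0) N = d := by
      simpa [lowerUnipotent] using Nat.gcd_eq_left hd
    rwa [hgd] at h
  have hVN : V N = 0 := by
    have h := hVl dvd_rfl
    rw [hGamma0 _ (CongruenceSubgroup.Gamma0_mem.mpr (by simp [lowerUnipotent]))] at h
    exact tendsto_nhds_unique h (tendsto_atImInfty_zero_of_norm_le (by omega) hbd)
  suffices hzero : ∀ d, d ∣ N → V d = 0 by
    intro σ
    rw [← hzero _ (Int.natCast_dvd_natCast.mp (Int.gcd_dvd_right (σ 1 0) N))]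
    exact hlim σ
  rcases Nat.lt_or_ge j 2 with hj1 | hj2
  · have hNsq : Squarefree N := by
      rw [hNfact]
      refine (Nat.squarefree_mul (Nat.Coprime.pow_left _ (Nat.coprime_two_left.mpr hN'odd))).mpr
        ⟨?_, hN'sqfree⟩
      interval_cases j
      · simp
      · simpa using Nat.prime_two.squarefree
    refine fun d hd => eq_zero_of_dvd_of_squarefree hNsq hVN (fun q d hq hd hqd hcop hz => ?_) hd
    have hq2 : ¬ q ^ 2 ∣ N := fun h => hq.not_isUnit (hNsq q (by rwa [← sq]))
    refine eq_zero_of_sub_one_mul_zpow hq hkpos hkeven hz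
      (cusp_relation hV hq hd hqd hcop fun z hz => ?_)
    rw [sum_translates_of_atkinLehnerU hkeven hq.pos
      (hU1 q hq (dvd_trans (dvd_mul_right ..) hqd) hq2) ⟨z, hz⟩]
    exact slash_dilation k (by exact_mod_cast hq.pos) (complexFourierSeries a) ⟨z, hz⟩
  · have hsum : ∀ z : ℂ, 0 < z.im →
        ∑ b ∈ Finset.range 2, complexFourierSeries a (z + b / (2 : ℕ)) =
          0 * complexFourierSeries a ((2 : ℕ) * z) := fun z hz => by
      rw [zero_mul]
      have h4N : 2 ^ 2 ∣ N := by
        rw [hNfact]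
        exact (pow_dvd_pow 2 hj2).mul_right N'
      have hU := hU2 2 Nat.prime_two h4N
      exact sum_translates_of_atkinLehnerU (F := complexFourierSeries a) hkeven two_pos hU ⟨z, hz⟩
    rw [hNfact] at hV hH hN hlim hVl ⊢
    refine fun d hd => eq_zero_of_dvd_of_four_dvd (k := k) hj2 (fun d hd h4 => ?_)
      (fun d hd hdo => ?_) (fun d e hde he => ?_) hd
    · refine cusp_value_eq_zero_of_four_dvd hV (Nat.pos_of_dvd_of_pos hd hN) hd h4 fun z hz => ?_
      simpa [Finset.sum_range_succ] using hsum z hz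
    · have h := cusp_relation hV Nat.prime_two hdo.pos hd (Nat.coprime_two_left.mpr hdo) hsum
      norm_num at h ⊢
      exact h
    · have hd0 : 0 < d := Nat.pos_of_dvd_of_pos ⟨e, hde⟩ hN
      have he0 : 0 < e := Nat.pos_of_dvd_of_pos ⟨d, by rw [hde, mul_comm]⟩ hN
      let σ : SL(2, ℤ) := ⟨!![-1, 0; (e : ℤ), -1], by simp⟩
      have hσ : Tendsto (slash k (sl2ToReal σ) (fourierSeries a)) atImInfty (𝓝 0) := by
        have hge : Int.gcd (σ 1 0) ((2 ^ j * N' : ℕ) : ℤ) = e := by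
          simp [σ, hde]
        have h := hlim σ
        rwa [hge, he] at h
      have hε0 : (ε : ℂ) ≠ 0 := by rcases hε with rfl | rfl <;> simp
      rw [hde] at hH
      refine tendsto_nhds_unique (hVl ⟨e, hde⟩)
        (tendsto_slash_lowerUnipotent_of_fricke hd0 he0 hε0 hH (σ := σ) ?_ hσ)
      ext i j
      fin_cases i <;> fin_cases j <;> simp [σ, sl2ToReal]
end

section
/- Let N be a positive integer, r a positive divisor of N, and a an integer with gcd(a·r, N/r) = 1. Then there exist γ ∈ Γ₀(N) and integers b, d such that γ · ((1,0),(ar,1)) = ((1,b),(−r,d)). (Lemma 6.) -/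
open UpperHalfPlane Matrix Complex MatrixGroups Asymptotics Filter Topology
open scoped Manifold

/-- **Lemma 6.** If `r | N` and `gcd(ar, N/r) = 1`, then there exists
`γ ∈ Γ₀(N)` with `γ · ((1,0),(ar,1)) = ((1,b),(−r,d))` for some integers
`b, d`. -/
theorem lemma_six
    (N r : ℕ) (hNpos : 0 < N) (hrpos : 0 < r) (hr : r ∣ N)
    (a : ℤ) (hcop : Int.gcd (a * (r : ℤ)) ((N / r : ℕ) : ℤ) = 1) :
    ∃ γ ∈ CongruenceSubgroup.Gamma0 N, ∃ b d : ℤ,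
      (γ : Matrix (Fin 2) (Fin 2) ℤ) * !![1, 0; a * (r : ℤ), 1]
        = !![1, b; -(r : ℤ), d] := by
  obtain ⟨M, rfl⟩ := hr
  rw [Nat.mul_div_cancel_left M hrpos] at hcop
  obtain ⟨u, v, huv⟩ := Int.isCoprime_iff_gcd_eq_one.mpr hcop
  set b : ℤ := (1 + a) * u with hb
  set d : ℤ := 1 - b * r with hd
  refine ⟨⟨!![1 - a * b * r, b; -r - d * a * r, d], ?_⟩, ?_, b, d, ?_⟩
  · rw [det_fin_two_of, hd]
    ring
  · have hlower : -(r : ℤ) - d * a * r = ((r * M : ℕ) : ℤ) * (-(v * (1 + a))) := by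
      rw [hd, hb]
      push_cast
      linear_combination ((r : ℤ) * (1 + a)) * huv
    exact CongruenceSubgroup.Gamma0_mem.mpr
      ((CharP.intCast_eq_zero_iff (ZMod (r * M)) (r * M) _).mpr ⟨_, hlower⟩)
  · ext i j
    fin_cases i <;> fin_cases j <;> simp [mul_apply, Fin.sum_univ_two] <;> ring
end

section
/- The group Γ₀(17) is generated by the five matrices P = ((1,1),(0,1)), W₁₇ = ((1,0),(17,1)), M₂ = ((2,1),(17,9)), M₃ = ((3,1),(17,6)), and M₆ = ((6,1),(17,3)). -/
open UpperHalfPlane Matrix Complex MatrixGroups Asymptotics Filter Topology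
open scoped Manifold

/-- The matrix `((1,0),(17,1))`. -/
def W17 : SL(2, ℤ) := ⟨!![1, 0; 17, 1], by norm_num [Matrix.det_fin_two_of]⟩

/-- The matrix `((2,1),(17,9))`. -/
def M2 : SL(2, ℤ) := ⟨!![2, 1; 17, 9], by norm_num [Matrix.det_fin_two_of]⟩

/-- The matrix `((3,1),(17,6))`. -/
def M3 : SL(2, ℤ) := ⟨!![3, 1; 17, 6], by norm_num [Matrix.det_fin_two_of]⟩

/-- The matrix `((6,1),(17,3))`. -/
def M6 : SL(2, ℤ) := ⟨!![6, 1; 17, 3], by norm_num [Matrix.det_fin_two_of]⟩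

lemma neg_one_eq_sq : (-1 : SL(2, ℤ)) = (M3⁻¹ * M2 * ModularGroup.T⁻¹ * M6) ^ 2 := by
  decide

section GeneratedSubgroup

variable {H : Subgroup SL(2, ℤ)}

lemma exists_mem_bottom_row_of_residue (hP : ModularGroup.T ∈ H) (hW : W17 ∈ H)
    (hA : M2 ∈ H) (hB : M3 ∈ H) (hC : M6 ∈ H) {r : ℤ} (h0 : 0 < r) (h17 : r < 17) :
    ∃ w ∈ H, (w 1 0 = 17 ∧ w 1 1 = r) ∨ (w 1 0 = -17 ∧ w 1 1 = -r) := by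
  interval_cases r
  · exact ⟨W17, hW, by decide⟩
  · exact ⟨M2⁻¹ * W17, mul_mem (inv_mem hA) hW, by decide⟩
  · exact ⟨M6, hC, by decide⟩
  · exact ⟨M6⁻¹ * ModularGroup.T * M2⁻¹ * M3,
      mul_mem (mul_mem (mul_mem (inv_mem hC) hP) (inv_mem hA)) hB, by decide⟩
  · exact ⟨M2⁻¹ * M3, mul_mem (inv_mem hA) hB, by decide⟩
  · exact ⟨M3, hB, by decide⟩
  · exact ⟨M6 * W17⁻¹ * M2, mul_mem (mul_mem hC (inv_mem hW)) hA, by decide⟩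
  · exact ⟨W17⁻¹ * M2, mul_mem (inv_mem hW) hA, by decide⟩
  · exact ⟨M2, hA, by decide⟩
  · exact ⟨M3⁻¹ * M2, mul_mem (inv_mem hB) hA, by decide⟩
  · exact ⟨M6⁻¹ * ModularGroup.T, mul_mem (inv_mem hC) hP, by decide⟩
  · exact ⟨M2⁻¹ * W17 * M6⁻¹ * ModularGroup.T,
      mul_mem (mul_mem (mul_mem (inv_mem hA) hW) (inv_mem hC)) hP, by decide⟩
  · exact ⟨M6 * W17⁻¹ * M2 * M3⁻¹ * ModularGroup.T,
      mul_mem (mul_mem (mul_mem (mul_mem hC (inv_mem hW)) hA) (inv_mem hB)) hP, by decide⟩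
  · exact ⟨M3⁻¹ * ModularGroup.T, mul_mem (inv_mem hB) hP, by decide⟩
  · exact ⟨M2⁻¹ * ModularGroup.T, mul_mem (inv_mem hA) hP, by decide⟩
  · exact ⟨W17⁻¹ * ModularGroup.T, mul_mem (inv_mem hW) hP, by decide⟩

lemma exists_mem_bottom_row (hP : ModularGroup.T ∈ H) (hW : W17 ∈ H)
    (hA : M2 ∈ H) (hB : M3 ∈ H) (hC : M6 ∈ H) {q : ℤ} (hq : ¬ 17 ∣ q) :
    ∃ w ∈ H, (w 1 0 = 17 ∧ w 1 1 = q) ∨ (w 1 0 = -17 ∧ w 1 1 = -q) := by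
  obtain ⟨w, hw, h⟩ := exists_mem_bottom_row_of_residue hP hW hA hB hC
    (r := q % 17) (by omega) (by omega)
  refine ⟨w * ModularGroup.T ^ (q / 17), mul_mem hw (zpow_mem hP _), ?_⟩
  have h10 : (w * ModularGroup.T ^ (q / 17)) 1 0 = w 1 0 := by
    simp [ModularGroup.coe_T_zpow, mul_apply]
  have h11 : (w * ModularGroup.T ^ (q / 17)) 1 1 = w 1 0 * (q / 17) + w 1 1 := by
    simp [ModularGroup.coe_T_zpow, mul_apply]
  rw [h10, h11]
  rcases h with ⟨h1, h2⟩ | ⟨h1, h2⟩ <;> rw [h1, h2] <;> omega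

lemma det_eq_one (g : SL(2, ℤ)) : g 0 0 * g 1 1 - g 0 1 * g 1 0 = 1 := by
  rw [← det_fin_two, g.det_coe]

lemma mem_of_lower_left_eq_zero (hP : ModularGroup.T ∈ H) (hneg : -1 ∈ H)
    {g : SL(2, ℤ)} (hc : g 1 0 = 0) : g ∈ H := by
  have hdet := det_eq_one g
  rw [hc, mul_zero, sub_zero] at hdet
  rcases Int.mul_eq_one_iff_eq_one_or_neg_one.mp hdet with ⟨ha, hd⟩ | ⟨ha, hd⟩
  · have : g = ModularGroup.T ^ (g 0 1) := by
      ext i j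
      fin_cases i <;> fin_cases j <;> simp [ModularGroup.coe_T_zpow, ha, hc, hd]
    rw [this]
    exact zpow_mem hP _
  · have : g = -1 * ModularGroup.T ^ (-g 0 1) := by
      ext i j
      fin_cases i <;> fin_cases j <;> simp [ModularGroup.coe_T_zpow, ha, hc, hd]
    rw [this]
    exact mul_mem hneg (zpow_mem hP _)

/-- An element of `Γ₀(17)` outside the stabiliser of `∞` can be multiplied by an element of `H`
so that its lower left entry decreases in absolute value. -/
lemma exists_mul_lower_left_lt (hP : ModularGroup.T ∈ H) (hW : W17 ∈ H)
    (hA : M2 ∈ H) (hB : M3 ∈ H) (hC : M6 ∈ H) {g : SL(2, ℤ)} {c : ℤ}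
    (hg : g 1 0 = 17 * c) (hc : c ≠ 0) :
    ∃ h ∈ H, ∃ c' : ℤ, (g * h) 1 0 = 17 * c' ∧ |c'| < |c| := by
  have hrem := Int.emod_add_mul_ediv (g 1 1) c
  have hnonneg := Int.emod_nonneg (g 1 1) hc
  have hlt := Int.emod_lt_abs (g 1 1) hc
  set q := g 1 1 / c
  set d := g 1 1 % c
  by_cases hq : 17 ∣ q
  · obtain ⟨m, hm⟩ := hq
    have hd : d ≠ 0 := by
      intro hd
      have hdet := det_eq_one g
      have : (17 : ℤ) ∣ 1 := ⟨g 0 0 * (c * m) - g 0 1 * c, by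
        linear_combination -hdet - g 0 0 * hrem + g 0 0 * hd + g 0 0 * c * hm - g 0 1 * hg⟩
      omega
    have hT (w : SL(2, ℤ)) :
        (g * (ModularGroup.T ^ (-m) * w)) 1 0 = 17 * c * w 0 0 + d * w 1 0 := by
      simp [ModularGroup.coe_T_zpow, mul_apply, vecMul, vecHead, vecTail, hg, ← hrem, hm]
      ring
    rcases lt_or_gt_of_ne hc with h | h
    · refine ⟨ModularGroup.T ^ (-m) * W17, mul_mem (zpow_mem hP _) hW, c + d, ?_, by grind⟩
      rw [hT, show W17 0 0 = 1 from rfl, show W17 1 0 = 17 from rfl]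
      ring
    · refine ⟨ModularGroup.T ^ (-m) * W17⁻¹, mul_mem (zpow_mem hP _) (inv_mem hW), c - d, ?_,
        by grind⟩
      rw [hT, show W17⁻¹ 0 0 = 1 from rfl, show W17⁻¹ 1 0 = -17 from rfl]
      ring
  · obtain ⟨w, hw, h⟩ := exists_mem_bottom_row hP hW hA hB hC hq
    have key : (g * w⁻¹) 1 0 = g 1 0 * w 1 1 - g 1 1 * w 1 0 := by
      simp [adjugate_fin_two, mul_apply, Fin.sum_univ_two]
      ring
    rcases h with ⟨h1, h2⟩ | ⟨h1, h2⟩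
    · refine ⟨w⁻¹, inv_mem hw, -d, ?_, by rwa [abs_neg, abs_of_nonneg hnonneg]⟩
      rw [key, h1, h2, hg, ← hrem]; ring
    · refine ⟨w⁻¹, inv_mem hw, d, ?_, by rwa [abs_of_nonneg hnonneg]⟩
      rw [key, h1, h2, hg, ← hrem]; ring

theorem Gamma0_seventeen_le (hP : ModularGroup.T ∈ H) (hW : W17 ∈ H)
    (hA : M2 ∈ H) (hB : M3 ∈ H) (hC : M6 ∈ H) : CongruenceSubgroup.Gamma0 17 ≤ H := by
  have hneg : (-1 : SL(2, ℤ)) ∈ H := by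
    rw [neg_one_eq_sq]
    exact pow_mem (mul_mem (mul_mem (mul_mem (inv_mem hB) hA) (inv_mem hP)) hC) 2
  have descent (n : ℕ) : ∀ (g : SL(2, ℤ)) (c : ℤ), g 1 0 = 17 * c → c.natAbs = n → g ∈ H := by
    induction n using Nat.strong_induction_on with
    | _ n ih =>
      intro g c hg hn
      by_cases hc : c = 0
      · exact mem_of_lower_left_eq_zero hP hneg (by rw [hg, hc, mul_zero])
      · obtain ⟨h, hh, c', hg', hlt⟩ := exists_mul_lower_left_lt hP hW hA hB hC hg hc
        have hmem := ih c'.natAbs (by grind) (g * h) c' hg' rfl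
        exact (Subgroup.mul_mem_cancel_right H hh).mp hmem
  intro g hg
  obtain ⟨c, hc⟩ := (ZMod.intCast_zmod_eq_zero_iff_dvd _ 17).mp
    (CongruenceSubgroup.Gamma0_mem.mp hg)
  exact descent _ g c (by exact_mod_cast hc) rfl

end GeneratedSubgroup

/-- `Γ₀(17)` is generated by `P = ((1,1),(0,1))`, `W₁₇ = ((1,0),(17,1))`,
`M₂ = ((2,1),(17,9))`, `M₃ = ((3,1),(17,6))`, and `M₆ = ((6,1),(17,3))`. -/
theorem gamma0_seventeen_generators :
    CongruenceSubgroup.Gamma0 17 = Subgroup.closure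
      ({⟨!![1, 1; 0, 1], by norm_num [Matrix.det_fin_two_of]⟩,
        ⟨!![1, 0; 17, 1], by norm_num [Matrix.det_fin_two_of]⟩,
        ⟨!![2, 1; 17, 9], by norm_num [Matrix.det_fin_two_of]⟩,
        ⟨!![3, 1; 17, 6], by norm_num [Matrix.det_fin_two_of]⟩,
        ⟨!![6, 1; 17, 3], by norm_num [Matrix.det_fin_two_of]⟩} :
        Set (Matrix.SpecialLinearGroup (Fin 2) ℤ)) := by
  apply le_antisymm
  · refine Gamma0_seventeen_le ?_ ?_ ?_ ?_ ?_ <;> apply Subgroup.subset_closure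
    · exact .inl rfl
    · exact .inr (.inl rfl)
    · exact .inr (.inr (.inl rfl))
    · exact .inr (.inr (.inr (.inl rfl)))
    · exact .inr (.inr (.inr (.inr rfl)))
  · rw [Subgroup.closure_le]
    rintro g (rfl | rfl | rfl | rfl | rfl) <;>
      exact CongruenceSubgroup.Gamma0_mem.mpr (by decide)
end

section
/- Let m₁, m₂ be coprime positive integers, k a positive even integer, and f : ℍ → ℂ with f|_k P = f (i.e. f(z+1) = f(z)). Then Σ_{1≤c≤m₁m₂, gcd(c,m₁m₂)=1} f|_k ((m₁m₂, c),(0, m₁m₂)) = Σ_{1≤a≤m₁, gcd(a,m₁)=1} Σ_{1≤b≤m₂, gcd(b,m₂)=1} f|_k ( ((m₁,a),(0,m₁)) · ((m₂,b),(0,m₂)) ). (The multiplicativity R_{m₁m₂} ≡ R_{m₁}R_{m₂} used in the proof of Theorem 2.) -/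
open UpperHalfPlane Matrix Complex MatrixGroups Asymptotics Filter Topology
open scoped Manifold

theorem glAct_upper (M c : ℝ) (hM : 0 < M) (z : ℍ) :
    glAct !![M, c; 0, M] z = (c / M) +ᵥ z := by
  have hdet : 0 < (!![M, c; 0, M] : Matrix (Fin 2) (Fin 2) ℝ).det := by
    simpa [Matrix.det_fin_two] using mul_pos hM hM
  rw [glAct, dif_pos hdet]
  apply UpperHalfPlane.ext
  have hM' : (M : ℂ) ≠ 0 := by exact_mod_cast hM.ne'
  rw [Subgroup.mk_smul, coe_smul_of_det_pos (by
    simpa [Matrix.GeneralLinearGroup.mkOfDetNeZero] using hdet)]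
  simp [num, denom, Matrix.GeneralLinearGroup.mkOfDetNeZero]
  field_simp
  ring

theorem apply_natCast_vadd {k : ℤ} {f : ℍ → ℂ} (hP : slash k !![1, 1; 0, 1] f = f)
    (n : ℕ) (z : ℍ) : f ((n : ℝ) +ᵥ z) = f z := by
  have h1 (w : ℍ) : f ((1 : ℝ) +ᵥ w) = f w := by
    conv_rhs => rw [← hP]
    simp [slash, glAct_upper]
  induction n with
  | zero => simp
  | succ n ih => rw [Nat.cast_succ, add_comm, add_vadd, h1, ih]

/-- The matrices `((M, c), (0, M))` act on a `1`-periodic function through `c` modulo `M`. -/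
theorem slash_upper_congr {k : ℤ} {f : ℍ → ℂ} (hP : slash k !![1, 1; 0, 1] f = f)
    {M c d : ℕ} (hM : 0 < M) (h : c ≡ d [MOD M]) (z : ℍ) :
    slash k !![(M : ℝ), (c : ℝ); 0, (M : ℝ)] f z =
      slash k !![(M : ℝ), (d : ℝ); 0, (M : ℝ)] f z := by
  wlog hcd : c ≤ d generalizing c d
  · exact (this h.symm (le_of_not_ge hcd)).symm
  obtain ⟨n, hn⟩ := (Nat.modEq_iff_dvd' hcd).1 h
  obtain rfl : d = M * n + c := by omega
  have hM' : (0 : ℝ) < M := by exact_mod_cast hM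
  have key : (((M * n + c : ℕ) : ℝ) / M) = (n : ℝ) + c / M := by
    push_cast
    field_simp
  simp only [slash, glAct_upper _ _ hM', key, add_vadd, apply_natCast_vadd hP]
  simp [Matrix.det_fin_two]

theorem eq_of_modEq_of_mem_Icc {m a b : ℕ} (ha : a ∈ Finset.Icc 1 m) (hb : b ∈ Finset.Icc 1 m)
    (h : a ≡ b [MOD m]) : a = b := by
  rw [Finset.mem_Icc] at ha hb
  have h' : a - 1 ≡ b - 1 [MOD m] := by
    apply Nat.ModEq.add_right_cancel' 1
    rwa [Nat.sub_add_cancel ha.1, Nat.sub_add_cancel hb.1]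
  have := h'.eq_of_lt_of_lt (by omega) (by omega)
  omega

theorem card_filter_coprime_Icc (m : ℕ) :
    ((Finset.Icc 1 m).filter (fun a => Nat.Coprime a m)).card = m.totient := by
  rw [← Nat.filter_coprime_Ico_eq_totient m 1]
  congr 1
  ext a
  simp only [Finset.mem_filter, Finset.mem_Icc, Finset.mem_Ico, Nat.coprime_comm (m := a)]
  omega

/-- A sum over reduced residues modulo `m₁ * m₂` as a double sum over reduced residues
modulo the coprime factors. -/
theorem sum_coprime_mul {A : Type*} [AddCommMonoid A] {m₁ m₂ : ℕ} (hm₁ : 0 < m₁) (hm₂ : 0 < m₂)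
    (hcop : Nat.Coprime m₁ m₂) (g : ℕ → A)
    (hg : ∀ c d, c ≡ d [MOD m₁ * m₂] → g c = g d) :
    ∑ c ∈ (Finset.Icc 1 (m₁ * m₂)).filter (fun c => Nat.Coprime c (m₁ * m₂)), g c =
      ∑ a ∈ (Finset.Icc 1 m₁).filter (fun a => Nat.Coprime a m₁),
        ∑ b ∈ (Finset.Icc 1 m₂).filter (fun b => Nat.Coprime b m₂), g (m₁ * b + a * m₂) := by
  have hM : 0 < m₁ * m₂ := Nat.mul_pos hm₁ hm₂
  let r : ℕ × ℕ → ℕ := fun p => (m₁ * p.2 + p.1 * m₂ - 1) % (m₁ * m₂) + 1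
  have hr (p : ℕ × ℕ) (hp : 1 ≤ p.1) : r p ≡ m₁ * p.2 + p.1 * m₂ [MOD m₁ * m₂] := by
    have h : 1 ≤ m₁ * p.2 + p.1 * m₂ := le_add_left (Nat.mul_pos hp hm₂)
    have := (Nat.mod_modEq (m₁ * p.2 + p.1 * m₂ - 1) (m₁ * m₂)).add_right 1
    rwa [Nat.sub_add_cancel h] at this
  rw [← Finset.sum_product']
  symm
  have hmaps : ∀ p ∈ (Finset.Icc 1 m₁).filter (fun a => Nat.Coprime a m₁) ×ˢ
      (Finset.Icc 1 m₂).filter (fun b => Nat.Coprime b m₂),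
      r p ∈ (Finset.Icc 1 (m₁ * m₂)).filter (fun c => Nat.Coprime c (m₁ * m₂)) := by
    rintro ⟨a, b⟩ hp
    simp only [Finset.mem_product, Finset.mem_filter, Finset.mem_Icc] at hp
    obtain ⟨⟨⟨ha, -⟩, ha'⟩, -, hb'⟩ := hp
    rw [Finset.mem_filter, Finset.mem_Icc]
    refine ⟨⟨Nat.le_add_left _ _, Nat.mod_lt _ hM⟩, ?_⟩
    rw [Nat.Coprime, (hr (a, b) ha).gcd_eq, ← Nat.Coprime, Nat.coprime_mul_iff_right]
    constructor
    · simpa [Nat.coprime_mul_iff_left] using ⟨ha', hcop.symm⟩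
    · simpa [Nat.coprime_mul_iff_left] using ⟨hcop, hb'⟩
  have hinj : Set.InjOn r ((Finset.Icc 1 m₁).filter (fun a => Nat.Coprime a m₁) ×ˢ
      (Finset.Icc 1 m₂).filter (fun b => Nat.Coprime b m₂) : Finset (ℕ × ℕ)) := by
    rintro ⟨a, b⟩ hp ⟨a', b'⟩ hp' h
    simp only [Finset.mem_coe, Finset.mem_product, Finset.mem_filter] at hp hp'
    have hmod : m₁ * b + a * m₂ ≡ m₁ * b' + a' * m₂ [MOD m₁ * m₂] :=
      (hr (a, b) (Finset.mem_Icc.1 hp.1.1).1).symm.trans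
        (h ▸ hr (a', b') (Finset.mem_Icc.1 hp'.1.1).1)
    have h₁ : a * m₂ ≡ a' * m₂ [MOD m₁] := by
      simpa [Nat.ModEq] using hmod.of_mul_right m₂
    have h₂ : m₁ * b ≡ m₁ * b' [MOD m₂] := by
      simpa [Nat.ModEq] using hmod.of_mul_left m₁
    exact Prod.ext
      (eq_of_modEq_of_mem_Icc hp.1.1 hp'.1.1 (h₁.cancel_right_of_coprime hcop))
      (eq_of_modEq_of_mem_Icc hp.2.1 hp'.2.1 (h₂.cancel_left_of_coprime hcop.symm))
  refine Finset.sum_nbij r hmaps hinj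
    (Finset.surjOn_of_injOn_of_card_le r hmaps hinj ?_) ?_
  · rw [Finset.card_product, card_filter_coprime_Icc, card_filter_coprime_Icc,
      card_filter_coprime_Icc, Nat.totient_mul hcop]
  · rintro ⟨a, b⟩ hp
    simp only [Finset.mem_product, Finset.mem_filter, Finset.mem_Icc] at hp
    exact (hg _ _ (hr (a, b) hp.1.1.1)).symm

/-- The multiplicativity `R_{m₁m₂} ≡ R_{m₁} R_{m₂}` used in the proof of
Theorem 2: for coprime `m₁, m₂` and `f` with `f|_k P = f`,
`Σ'_{c (m₁m₂)} f|_k ((m₁m₂,c),(0,m₁m₂)) =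
 Σ'_{a (m₁)} Σ'_{b (m₂)} f|_k (((m₁,a),(0,m₁)) ((m₂,b),(0,m₂)))`. -/
theorem R_multiplicative
    (m₁ m₂ : ℕ) (hm₁ : 0 < m₁) (hm₂ : 0 < m₂) (hcop : Nat.Coprime m₁ m₂)
    (k : ℤ) (hkpos : 0 < k) (hkeven : Even k)
    (f : ℍ → ℂ)
    (hP : slash k !![1, 1; 0, 1] f = f) :
    (fun z => ∑ c ∈ (Finset.Icc 1 (m₁ * m₂)).filter
        (fun c => Nat.Coprime c (m₁ * m₂)),
      slash k !![((m₁ * m₂ : ℕ) : ℝ), (c : ℝ); 0, ((m₁ * m₂ : ℕ) : ℝ)] f z) =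
    (fun z => ∑ a ∈ (Finset.Icc 1 m₁).filter (fun a => Nat.Coprime a m₁),
      ∑ b ∈ (Finset.Icc 1 m₂).filter (fun b => Nat.Coprime b m₂),
        slash k (!![(m₁ : ℝ), (a : ℝ); 0, (m₁ : ℝ)] *
          !![(m₂ : ℝ), (b : ℝ); 0, (m₂ : ℝ)]) f z) := by
  funext z
  rw [sum_coprime_mul hm₁ hm₂ hcop _
    (fun c d h => slash_upper_congr hP (Nat.mul_pos hm₁ hm₂) h z)]
  refine Finset.sum_congr rfl fun a _ => Finset.sum_congr rfl fun b _ => ?_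
  congr 1
  simp
end

section
/- Let χ₃ be the nontrivial Dirichlet character modulo 3. The function Φ(s) = (3/(2π))^s Γ(s) L(s,χ₃) L(s−1,χ₃) extends to an entire function of s which is bounded in every vertical strip and satisfies Φ(s) = Φ(2−s). In the convention Φ(s) = ε(−1)^{k/2} Φ(k−s) with k = 2, this is a functional equation of degree 2, level 9, and weight 2 with sign ε = −1. (The example showing that the growth assumption in Corollary 1 cannot be eliminated for N = 9.) -/
open UpperHalfPlane Matrix Complex MatrixGroups Asymptotics Filter Topology
open scoped Manifold

/-- A complex function is bounded in vertical strips if it is bounded on every closed vertical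
strip of finite width. -/
def BoundedInVerticalStrips (f : ℂ → ℂ) : Prop :=
  ∀ σ₁ σ₂ : ℝ, ∃ M : ℝ, ∀ s : ℂ, σ₁ ≤ s.re → s.re ≤ σ₂ → ‖f s‖ ≤ M

namespace BoundedInVerticalStrips

variable {f g : ℂ → ℂ}

lemma const (c : ℂ) : BoundedInVerticalStrips fun _ ↦ c :=
  fun _ _ ↦ ⟨‖c‖, fun _ _ _ ↦ le_rfl⟩

lemma mul (hf : BoundedInVerticalStrips f) (hg : BoundedInVerticalStrips g) :
    BoundedInVerticalStrips fun s ↦ f s * g s := by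
  intro σ₁ σ₂
  obtain ⟨M, hM⟩ := hf σ₁ σ₂
  obtain ⟨M', hM'⟩ := hg σ₁ σ₂
  refine ⟨M * M', fun s h₁ h₂ ↦ ?_⟩
  rw [norm_mul]
  exact mul_le_mul (hM s h₁ h₂) (hM' s h₁ h₂) (norm_nonneg _)
    ((norm_nonneg _).trans (hM s h₁ h₂))

lemma sum {ι : Type*} (t : Finset ι) {F : ι → ℂ → ℂ}
    (hF : ∀ i ∈ t, BoundedInVerticalStrips (F i)) :
    BoundedInVerticalStrips fun s ↦ ∑ i ∈ t, F i s := by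
  intro σ₁ σ₂
  choose! M hM using fun i hi ↦ hF i hi σ₁ σ₂
  exact ⟨∑ i ∈ t, M i, fun s h₁ h₂ ↦ norm_sum_le_of_le t fun i hi ↦ hM i hi s h₁ h₂⟩

lemma comp_add_const (hf : BoundedInVerticalStrips f) (c : ℂ) :
    BoundedInVerticalStrips fun s ↦ f (s + c) := by
  intro σ₁ σ₂
  obtain ⟨M, hM⟩ := hf (σ₁ + c.re) (σ₂ + c.re)
  exact ⟨M, fun s h₁ h₂ ↦ hM _ (by simpa using h₁) (by simpa using h₂)⟩

lemma comp_div_two (hf : BoundedInVerticalStrips f) :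
    BoundedInVerticalStrips fun s ↦ f (s / 2) := by
  intro σ₁ σ₂
  obtain ⟨M, hM⟩ := hf (σ₁ / 2) (σ₂ / 2)
  have hre (s : ℂ) : (s / 2).re = s.re / 2 := by simp
  exact ⟨M, fun s h₁ h₂ ↦ hM _ (by rw [hre]; gcongr) (by rw [hre]; gcongr)⟩

lemma comp_neg (hf : BoundedInVerticalStrips f) : BoundedInVerticalStrips fun s ↦ f (-s) := by
  intro σ₁ σ₂
  obtain ⟨M, hM⟩ := hf (-σ₂) (-σ₁)
  exact ⟨M, fun s h₁ h₂ ↦ hM _ (by simpa using h₂) (by simpa using h₁)⟩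

end BoundedInVerticalStrips

lemma Real.rpow_le_rpow_add_rpow {t : ℝ} (ht : 0 < t) {x a b : ℝ} (ha : a ≤ x) (hb : x ≤ b) :
    t ^ x ≤ t ^ a + t ^ b := by
  have hta := Real.rpow_nonneg ht.le a
  have htb := Real.rpow_nonneg ht.le b
  rcases le_total t 1 with h | h
  · linarith [Real.rpow_le_rpow_of_exponent_ge ht h ha]
  · linarith [Real.rpow_le_rpow_of_exponent_le h hb]

lemma boundedInVerticalStrips_ofReal_cpow {a : ℝ} (ha : 0 < a) :
    BoundedInVerticalStrips fun s ↦ (a : ℂ) ^ s := fun σ₁ σ₂ ↦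
  ⟨a ^ σ₁ + a ^ σ₂, fun s h₁ h₂ ↦ by
    rw [Complex.norm_cpow_eq_rpow_re_of_pos ha]
    exact Real.rpow_le_rpow_add_rpow ha h₁ h₂⟩

open MeasureTheory Set in
/-- An everywhere convergent Mellin transform is bounded in vertical strips. -/
lemma boundedInVerticalStrips_mellin {f : ℝ → ℂ} (hf : ∀ s, MellinConvergent f s) :
    BoundedInVerticalStrips (mellin f) := by
  intro σ₁ σ₂
  have hnorm (s : ℂ) {t : ℝ} (ht : t ∈ Ioi (0 : ℝ)) :
      ‖(t : ℂ) ^ (s - 1) • f t‖ = t ^ (s.re - 1) * ‖f t‖ := by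
    rw [norm_smul, Complex.norm_cpow_eq_rpow_re_of_pos ht]
    simp
  have hint (σ : ℝ) : IntegrableOn (fun t : ℝ ↦ t ^ (σ - 1) * ‖f t‖) (Ioi 0) :=
    (integrableOn_congr_fun (fun t ht ↦ by simpa using hnorm σ ht) measurableSet_Ioi).mp
      (hf σ).norm
  refine ⟨∫ t in Ioi (0 : ℝ), (t ^ (σ₁ - 1) * ‖f t‖ + t ^ (σ₂ - 1) * ‖f t‖), fun s h₁ h₂ ↦ ?_⟩
  refine norm_integral_le_of_norm_le ((hint σ₁).add (hint σ₂)) ?_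
  refine (ae_restrict_iff' measurableSet_Ioi).mpr (.of_forall fun t ht ↦ ?_)
  rw [hnorm s ht, ← add_mul]
  gcongr
  exact Real.rpow_le_rpow_add_rpow ht (by linarith) (by linarith)

lemma boundedInVerticalStrips_completedHurwitzZetaOdd (a : UnitAddCircle) :
    BoundedInVerticalStrips (HurwitzZeta.completedHurwitzZetaOdd a) := by
  have hP := HurwitzZeta.isStrong_hurwitzOddFEPair a
  have hΛ : BoundedInVerticalStrips (HurwitzZeta.hurwitzOddFEPair a).Λ := by
    rw [hP.Λ_eq]
    exact boundedInVerticalStrips_mellin fun s ↦ (hP.hasMellin s).1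
  exact (hΛ.comp_div_two.comp_add_const 1).mul (.const 2⁻¹)

namespace DirichletCharacter

lemma Odd.boundedInVerticalStrips_completedLFunction {N : ℕ} [NeZero N]
    {χ : DirichletCharacter ℂ N} (hχ : χ.Odd) :
    BoundedInVerticalStrips χ.completedLFunction := by
  have hN : BoundedInVerticalStrips fun s ↦ ((N : ℝ) : ℂ) ^ s :=
    boundedInVerticalStrips_ofReal_cpow (by exact_mod_cast NeZero.pos N)
  have hΛ (s : ℂ) : χ.completedLFunction s = ((N : ℝ) : ℂ) ^ (-s) *
      ∑ j, χ j * HurwitzZeta.completedHurwitzZetaOdd (ZMod.toAddCircle j) s := by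
    rw [ofReal_natCast]
    exact ZMod.completedLFunction_def_odd hχ.to_fun s
  rw [funext hΛ]
  exact hN.comp_neg.mul <| .sum _ fun j _ ↦
    (BoundedInVerticalStrips.const _).mul (boundedInVerticalStrips_completedHurwitzZetaOdd _)

/-- The product `L(s, χ) L(s - 1, χ)` in terms of completed `L`-functions, for odd `χ`. -/
lemma Odd.completedLFunction_mul_completedLFunction_sub_one {N : ℕ} [NeZero N]
    {χ : DirichletCharacter ℂ N} (hχ : χ.Odd) {s : ℂ} (hs : ∀ n : ℕ, s ≠ -(n : ℂ)) :
    χ.completedLFunction s * χ.completedLFunction (s - 1) =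
      Gammaℂ s * χ.LFunction s * χ.LFunction (s - 1) := by
  have h₀ : Gammaℝ s ≠ 0 := by
    rw [Ne, Gammaℝ_eq_zero_iff]
    rintro ⟨n, hn⟩
    exact hs (2 * n) (by rw [hn]; push_cast; ring)
  have h₁ : Gammaℝ (s + 1) ≠ 0 := by
    rw [Ne, Gammaℝ_eq_zero_iff]
    rintro ⟨n, hn⟩
    exact hs (2 * n + 1) (by rw [eq_sub_of_add_eq hn]; push_cast; ring)
  have hL (s : ℂ) : χ.LFunction s = χ.completedLFunction s / Gammaℝ (s + 1) :=
    ZMod.LFunction_eq_completed_div_gammaFactor_odd hχ.to_fun s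
  rw [← Gammaℝ_mul_Gammaℝ_add_one, hL s, hL (s - 1), sub_add_cancel]
  field_simp

/-- For a primitive quadratic character, the square of the root number may be dropped in front
of the completed `L`-function. -/
lemma IsPrimitive.rootNumber_sq_mul_completedLFunction {N : ℕ} [NeZero N]
    {χ : DirichletCharacter ℂ N} (hχ : χ.IsPrimitive) (hinv : χ⁻¹ = χ) (s : ℂ) :
    χ.rootNumber ^ 2 * χ.completedLFunction s = χ.completedLFunction s := by
  have h₁ := hχ.completedLFunction_one_sub (1 - s)
  rw [sub_sub_cancel, hinv, hχ.completedLFunction_one_sub s, hinv] at h₁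
  have hN : (N : ℂ) ^ (1 - s - 1 / 2) * (N : ℂ) ^ (s - 1 / 2) = 1 := by
    rw [← Complex.cpow_add _ _ (NeZero.ne _)]
    ring_nf
    simp
  linear_combination -h₁ - χ.rootNumber ^ 2 * χ.completedLFunction s * hN

/-- Functional equation under `s ↦ 2 - s` for a primitive quadratic character. -/
lemma IsPrimitive.cpow_mul_completedLFunction_two_sub {N : ℕ} [NeZero N]
    {χ : DirichletCharacter ℂ N} (hχ : χ.IsPrimitive) (hinv : χ⁻¹ = χ) (s : ℂ) :
    (N : ℂ) ^ (2 - s) * (χ.completedLFunction (2 - s) * χ.completedLFunction (2 - s - 1)) =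
      (N : ℂ) ^ s * (χ.completedLFunction s * χ.completedLFunction (s - 1)) := by
  have h₁ := hχ.completedLFunction_one_sub (s - 1)
  have h₂ := hχ.completedLFunction_one_sub s
  rw [hinv] at h₁ h₂
  rw [show 1 - (s - 1) = 2 - s by ring] at h₁
  rw [show 2 - s - 1 = 1 - s by ring, h₁, h₂]
  have hN : (N : ℂ) ^ (2 - s) * (N : ℂ) ^ (s - 1 - 1 / 2) * (N : ℂ) ^ (s - 1 / 2) =
      (N : ℂ) ^ s := by
    rw [← Complex.cpow_add _ _ (NeZero.ne _), ← Complex.cpow_add _ _ (NeZero.ne _)]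
    ring_nf
  rw [← hN]
  linear_combination (N : ℂ) ^ (2 - s) * (N : ℂ) ^ (s - 1 - 1 / 2) * (N : ℂ) ^ (s - 1 / 2) *
    χ.completedLFunction (s - 1) * hχ.rootNumber_sq_mul_completedLFunction hinv s

lemma odd_of_ne_one_three {χ : DirichletCharacter ℂ 3} (hχ : χ ≠ 1) : χ.Odd := by
  refine χ.even_or_odd.resolve_left fun he ↦ hχ (MulChar.ext fun a ↦ ?_)
  rcases (by decide : ∀ a : (ZMod 3)ˣ, a = 1 ∨ a = -1) a with rfl | rfl
  · simp
  · rw [MulChar.one_apply_coe, Units.val_neg, Units.val_one]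
    exact he

lemma isPrimitive_of_ne_one_three {χ : DirichletCharacter ℂ 3} (hχ : χ ≠ 1) : χ.IsPrimitive :=
  ((Nat.dvd_prime Nat.prime_three).mp χ.conductor_dvd_level).resolve_left
    fun h ↦ hχ (χ.eq_one_iff_conductor_eq_one.mpr h)

lemma inv_eq_self_three (χ : DirichletCharacter ℂ 3) : χ⁻¹ = χ := by
  ext a
  rw [MulChar.inv_apply, Ring.inverse_unit, (by decide : ∀ a : (ZMod 3)ˣ, a⁻¹ = a) a]

end DirichletCharacter

/-- The example showing the growth assumption in Corollary 1 cannot be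
eliminated for `N = 9`: for the nontrivial Dirichlet character `χ₃` mod 3,
`Φ(s) = (3/(2π))^s Γ(s) L(s,χ₃) L(s−1,χ₃)` extends to an entire function,
bounded in vertical strips, with `Φ(s) = Φ(2−s)`; in the convention
`Φ(s) = ε(−1)^{k/2} Φ(k−s)` with `k = 2` this is a functional equation of
degree 2, level 9, and weight 2 with sign `ε = −1`. -/
theorem eisenstein_example_level_nine
    (χ : DirichletCharacter ℂ 3) (hχ : χ ≠ 1) :
    ∃ Φ : ℂ → ℂ, Differentiable ℂ Φ ∧
      (∀ s : ℂ, (∀ n : ℕ, s ≠ -(n : ℂ)) →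
        Φ s = ((3 : ℂ) / (2 * (Real.pi : ℂ))) ^ s * Complex.Gamma s *
          DirichletCharacter.LFunction χ s *
          DirichletCharacter.LFunction χ (s - 1)) ∧
      (∀ σ₁ σ₂ : ℝ, ∃ M : ℝ, ∀ s : ℂ, σ₁ ≤ s.re → s.re ≤ σ₂ → ‖Φ s‖ ≤ M) ∧
      (∀ s : ℂ, Φ s = Φ (2 - s)) ∧
      (∀ s : ℂ, Φ s =
        ((-1 : ℝ) : ℂ) * (-1 : ℂ) ^ ((2 : ℤ) / 2) * Φ ((2 : ℂ) - s)) := by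
  have hodd := DirichletCharacter.odd_of_ne_one_three hχ
  have hprim := DirichletCharacter.isPrimitive_of_ne_one_three hχ
  have hdiff := DirichletCharacter.differentiable_completedLFunction hχ
  have hbdd := hodd.boundedInVerticalStrips_completedLFunction
  let Φ : ℂ → ℂ := fun s ↦
    2⁻¹ * ((3 : ℂ) ^ s * (χ.completedLFunction s * χ.completedLFunction (s - 1)))
  have hfe (s : ℂ) : Φ s = Φ (2 - s) := by
    have := hprim.cpow_mul_completedLFunction_two_sub χ.inv_eq_self_three s
    rw [Nat.cast_ofNat] at this
    simp only [Φ, this]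
  refine ⟨Φ, by fun_prop (disch := simp), fun s hs ↦ ?_, ?_, hfe, fun s ↦ ?_⟩
  · have h2π : ((3 : ℂ) / (2 * (Real.pi : ℂ))) ^ s = 3 ^ s * (2 * (Real.pi : ℂ)) ^ (-s) := by
      have h := mul_cpow_ofReal_nonneg (r := s) (a := 3 / (2 * Real.pi)) (b := 2 * Real.pi)
        (by positivity) (by positivity)
      push_cast at h
      have hπ : 2 * (Real.pi : ℂ) ≠ 0 := by simp [Real.pi_ne_zero]
      rw [div_mul_cancel₀ _ hπ] at h
      rw [h, mul_assoc, ← cpow_add _ _ hπ, add_neg_cancel, cpow_zero, mul_one]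
    simp only [Φ]
    rw [hodd.completedLFunction_mul_completedLFunction_sub_one hs, h2π, Gammaℂ_def]
    ring
  · have h3 : BoundedInVerticalStrips fun s ↦ (3 : ℂ) ^ s := by
      simpa using boundedInVerticalStrips_ofReal_cpow (a := 3) (by norm_num)
    exact (BoundedInVerticalStrips.const _).mul
      (h3.mul (hbdd.mul (by simpa [sub_eq_add_neg] using hbdd.comp_add_const (-1))))
  · rw [← hfe]
    norm_num
end
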